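/- For any integer l ≥ 5 and complex numbers x, y, one has G_l^4(x+y, y) + G_l^4(y+x, x) = ((l+1)(l²−7l+18)/24)(x^{l−4} + y^{l−4}) ζ(l) − (1/6) Σ_{j₁≥2, j₂≥4, j₁+j₂=l} (j₂−1)(j₂−2)(x^{j₁−1} − y^{j₁−1})(x^{j₂−3} − y^{j₂−3}) ζ(j₁) ζ(j₂) − (1/8) Σ_{j₁,j₂≥3, j₁+j₂=l} (j₁−1)(j₂−1)(x^{j₁−2} + y^{j₁−2})(x^{j₂−2} + y^{j₂−2}) ζ(j₁) ζ(j₂) + (1/4) Σ_{j₁,j₂≥2, j₃≥3, j₁+j₂+j₃=l} (j₃−1)(x^{j₁−1} − y^{j₁−1})(x^{j₂−1} − y^{j₂−1})(x^{j₃−2} + y^{j₃−2}) ζ(j₁) ζ(j₂) ζ(j₃) − (1/24) Σ_{j₁,j₂,j₃,j₄≥2, j₁+j₂+j₃+j₄=l} Π_{i=1}^{4} (x^{j_i−1} − y^{j_i−1}) ζ(j_i). -/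

import Mathlib

open scoped BigOperators

/-- The multiple zeta value `ζ(l₁, …, lₙ)`, as a sum over strictly decreasing
tuples of positive integers. -/
noncomputable def mzv {n : ℕ} (l : Fin n → ℕ) : ℝ :=
  ∑' m : {m : Fin n → ℕ // StrictAnti m ∧ ∀ i, 0 < m i},
    ∏ i, ((m.1 i : ℝ) ^ (l i))⁻¹

/-- The Riemann zeta value `ζ(k)`. -/
noncomputable def rz (k : ℕ) : ℝ := ∑' m : ℕ+, ((m : ℝ) ^ k)⁻¹

/-- The weighted sum with two parameters
`G_l^n(x,y) = Σ_{l₁≥2, l₂,…,lₙ≥1, l₁+⋯+lₙ=l} x^(l₁-1) y^(l-l₁-(n-1)) ζ(l₁,…,lₙ)`. -/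
noncomputable def G (l n : ℕ) (x y : ℂ) : ℂ :=
  match n with
  | 0 => 0
  | k + 1 =>
    ∑ c ∈ (Finset.Nat.antidiagonalTuple (k + 1) l).filter
        (fun c => 2 ≤ c 0 ∧ ∀ i, 1 ≤ c i),
      x ^ (c 0 - 1) * y ^ (l - c 0 - k) * (mzv c : ℂ)

section GeneratingFunctions

open PowerSeries Finset Filter Topology
open scoped PowerSeries.WithPiTopology

section Algebra
variable {R : Type*} [CommRing R]

/-- The product `∏_{j < n} (1 + w ι_j)`. -/
def risingProd (w : R) (ι : ℕ → R) (n : ℕ) : R := ∏ j ∈ range n, (1 + w * ι j)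

lemma risingProd_zero (w : R) (ι : ℕ → R) : risingProd w ι 0 = 1 := by simp [risingProd]

lemma risingProd_succ (w : R) (ι : ℕ → R) (n : ℕ) :
    risingProd w ι (n + 1) = risingProd w ι n * (1 + w * ι n) := by
  simp [risingProd, prod_range_succ]

/-- The sequence of increments of `n ↦ risingProd w ι n`, starting with `1`. -/
def risingCoeff (w : R) (ι : ℕ → R) : ℕ → R
  | 0 => 1
  | n + 1 => w * ι n * risingProd w ι n

lemma sum_risingCoeff (w : R) (ι : ℕ → R) (n : ℕ) :
    ∑ i ∈ range (n + 1), risingCoeff w ι i = risingProd w ι n := by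
  induction n with
  | zero => simp [risingCoeff, risingProd]
  | succ n ih => rw [sum_range_succ, ih, risingProd_succ, risingCoeff]; ring

/-- The generating series of `risingCoeff w ι`. -/
def risingSeries (w : R) (ι : ℕ → R) : R⟦X⟧ := PowerSeries.mk (risingCoeff w ι)

lemma coeff_one_sub_X_mul (f : R⟦X⟧) (n : ℕ) :
    coeff (n + 1) ((1 - X) * f) = coeff (n + 1) f - coeff n f := by
  rw [sub_mul, one_mul, map_sub, coeff_succ_X_mul]

lemma risingSeries_ode {w x : R} {ι : ℕ → R} (h : ∀ n, ι n * ((n : R) + 1 - x) = 1) :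
    (1 - X) * (X * derivative R (risingSeries w ι) - C x * risingSeries w ι + C x)
      = C w * (X * risingSeries w ι) := by
  have hc : ∀ n, coeff (n + 1) (X * derivative R (risingSeries w ι) - C x * risingSeries w ι + C x)
      = w * risingProd w ι n := by
    intro n
    rw [map_add, map_sub, coeff_succ_X_mul, coeff_derivative, coeff_C_mul, coeff_C,
      if_neg (Nat.succ_ne_zero n)]
    simp only [risingSeries, coeff_mk, risingCoeff]
    linear_combination w * risingProd w ι n * h n
  ext n
  cases n with
  | zero => simp [risingSeries, risingCoeff]
  | succ n =>
    rw [coeff_one_sub_X_mul, hc, coeff_C_mul, coeff_succ_X_mul]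
    cases n with
    | zero => simp [risingSeries, risingCoeff, risingProd]
    | succ n =>
      rw [hc, risingProd_succ]
      simp only [risingSeries, coeff_mk, risingCoeff]
      ring

lemma coeff_risingSeries_mul {w x y : R} {ι κ : ℕ → R} (hι : ∀ n, ι n * ((n : R) + 1 - x) = 1)
    (hκ : ∀ n, κ n * ((n : R) + 1 - y) = 1) (n : ℕ) :
    coeff n (risingSeries w ι * risingSeries (-w) κ) * (n - x - y)
      = -(x * risingCoeff (-w) κ n) - y * risingCoeff w ι n := by
  have h1 := risingSeries_ode (w := w) hι
  have h2 := risingSeries_ode (w := -w) hκ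
  set a := risingSeries w ι
  set b := risingSeries (-w) κ
  have h : X * derivative R (a * b) - C (x + y) * (a * b) = -(C x * b) - C y * a := by
    have key : (1 - X) * (X * derivative R (a * b) - C (x + y) * (a * b))
        = (1 - X) * (-(C x * b) - C y * a) := by
      rw [Derivation.leibniz]
      simp only [map_add, smul_eq_mul, map_neg] at h1 h2 ⊢
      linear_combination b * h1 + a * h2
    have := congrArg (fun f => (PowerSeries.mk 1 : R⟦X⟧) * f) key
    simpa only [← mul_assoc, mk_one_mul_one_sub_eq_one, one_mul] using this
  have h3 := congrArg (coeff n) h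
  rw [map_sub, map_sub, map_neg, coeff_C_mul, coeff_C_mul, coeff_C_mul] at h3
  have h4 : coeff n (X * derivative R (a * b)) = coeff n (a * b) * n := by
    cases n with
    | zero => simp
    | succ n => rw [coeff_succ_X_mul, coeff_derivative]; push_cast; ring
  rw [h4] at h3
  simp only [a, b, risingSeries, coeff_mk] at h3 ⊢
  linear_combination h3

lemma risingSeries_mul_neg {w : R} {ι : ℕ → R} (hι : ∀ n, ι n * ((n : R) + 1) = 1) :
    risingSeries w ι * risingSeries (-w) ι = 1 := by
  have h : ∀ n, ι n * ((n : R) + 1 - 0) = 1 := by simpa using hι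
  ext n
  cases n with
  | zero => simp [risingSeries, risingCoeff]
  | succ n =>
    have h1 := coeff_risingSeries_mul (w := w) h h (n + 1)
    push_cast at h1
    rw [coeff_one, if_neg (Nat.succ_ne_zero n)]
    linear_combination ι n * h1 - coeff (n + 1) (risingSeries w ι * risingSeries (-w) ι) * h n

end Algebra

section Algebra
variable {R : Type*} [CommRing R]

lemma coeff_mk_one_mul (f : R⟦X⟧) (n : ℕ) :
    coeff n (PowerSeries.mk 1 * f) = ∑ i ∈ range (n + 1), coeff i f := by
  rw [mul_comm, coeff_mul, Finset.Nat.sum_antidiagonal_eq_sum_range_succ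
    (fun i j => coeff i f * coeff j (PowerSeries.mk 1 : R⟦X⟧))]
  simp

lemma risingProd_eq_sum (w : R) (ι κ : ℕ → R) (hκ : ∀ n, κ n * ((n : R) + 1) = 1) (n : ℕ) :
    risingProd w ι n = ∑ k ∈ range (n + 1),
      coeff k (risingSeries w ι * risingSeries (-w) κ) * risingProd w κ (n - k) := by
  have hs : ∀ (ι : ℕ → R) n, coeff n (PowerSeries.mk 1 * risingSeries w ι) = risingProd w ι n := by
    intro ι n
    rw [coeff_mk_one_mul, ← sum_risingCoeff]
    simp [risingSeries]
  have h : PowerSeries.mk 1 * risingSeries w ι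
      = risingSeries w ι * risingSeries (-w) κ * (PowerSeries.mk 1 * risingSeries w κ) := by
    linear_combination (-(PowerSeries.mk 1 * risingSeries w ι)) * risingSeries_mul_neg (w := w) hκ
  rw [← hs, h, coeff_mul, Finset.Nat.sum_antidiagonal_eq_sum_range_succ
    (fun i j => coeff i (risingSeries w ι * risingSeries (-w) κ)
      * coeff j (PowerSeries.mk 1 * risingSeries w κ))]
  simp only [hs]

/-- The shifted products `ι_{N+n} ∏_{j < N} (j + 1 - y + z) ι_{j+n}`. -/
def shiftedProd (y z : R) (ι : ℕ → R) (n N : ℕ) : R :=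
  ι (N + n) * ∏ j ∈ range N, (((j : R) + 1 - y + z) * ι (j + n))

lemma shiftedProd_sub_succ {y z : R} {ι : ℕ → R} (hι : ∀ n, ι n * ((n : R) + 1 - y) = 1)
    (n N : ℕ) : shiftedProd y z ι n N - shiftedProd y z ι n (N + 1)
      = (n + 1 - z) * (shiftedProd y z ι n N * ι (N + n + 1)) := by
  have h := hι (N + n + 1)
  push_cast at h
  simp only [shiftedProd, prod_range_succ]
  rw [show N + 1 + n = N + n + 1 by ring]
  linear_combination (-(ι (N + n) * ∏ j ∈ range N, (((j : R) + 1 - y + z) * ι (j + n)))) * h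

lemma shiftedProd_succ_left {y z : R} {ι : ℕ → R} (hι : ∀ n, ι n * ((n : R) + 1 - y) = 1)
    (n N : ℕ) : shiftedProd y z ι (n + 1) N
      = (n + 1 - y) * (shiftedProd y z ι n N * ι (N + n + 1)) := by
  have h : ∀ N, ι n * ∏ j ∈ range N, ι (j + (n + 1)) = (∏ j ∈ range N, ι (j + n)) * ι (N + n) := by
    intro N
    rw [← prod_range_succ (fun j => ι (j + n)), prod_range_succ', mul_comm]
    simp only [add_assoc, add_comm 1, zero_add]
  simp only [shiftedProd, prod_mul_distrib]
  rw [show N + (n + 1) = N + n + 1 by ring]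
  linear_combination (-(ι (N + n + 1) * (∏ j ∈ range N, ((j : R) + 1 - y + z))
      * ∏ j ∈ range N, ι (j + (n + 1)))) * hι n
    + ((n : R) + 1 - y) * ι (N + n + 1) * (∏ j ∈ range N, ((j : R) + 1 - y + z)) * h N

lemma shiftedProd_telescope {y z : R} {ι ζ κ : ℕ → R} (hι : ∀ n, ι n * ((n : R) + 1 - y) = 1)
    (hζ : ∀ n, ζ n * ((n : R) + 1 - z) = 1) (hκ : ∀ n, κ n * ((n : R) + 1) = 1) (n N : ℕ) :
    κ N * shiftedProd y z ι n N - κ N * shiftedProd y z ι (n + 1) N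
      = ζ n * (shiftedProd y z ι n N - shiftedProd y z ι n (N + 1)) := by
  have h := hι (N + n + 1)
  push_cast at h
  rw [shiftedProd_sub_succ hι, shiftedProd_succ_left hι]
  linear_combination (-(κ N * shiftedProd y z ι n N)) * h
    - (shiftedProd y z ι n N * ι (N + n + 1)) * hζ n
    + (shiftedProd y z ι n N * ι (N + n + 1)) * hκ N

end Algebra

/-- The weighted `ℓ¹` seminorm `∑_{d < D} r ^ d * p (f_d)` on power series. -/
noncomputable def truncSeminorm {B : Type*} [CommRing B] (p : RingSeminorm B) (r : ℝ) (hr : 0 ≤ r)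
    (D : ℕ) : RingSeminorm B⟦X⟧ where
  toFun f := ∑ d ∈ range D, r ^ d * p (coeff d f)
  map_zero' := by simp
  add_le' f g := by
    rw [← sum_add_distrib]
    refine sum_le_sum fun d _ => ?_
    rw [map_add, ← mul_add]
    exact mul_le_mul_of_nonneg_left (map_add_le_add p _ _) (pow_nonneg hr d)
  neg' f := by simp
  mul_le' f g := by
    have h0 : ∀ f : B⟦X⟧, ∀ d, 0 ≤ r ^ d * p (coeff d f) := fun f d =>
      mul_nonneg (pow_nonneg hr d) (apply_nonneg p _)
    calc ∑ d ∈ range D, r ^ d * p (coeff d (f * g))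
        ≤ ∑ d ∈ range D, ∑ ij ∈ antidiagonal d,
            (r ^ ij.1 * p (coeff ij.1 f)) * (r ^ ij.2 * p (coeff ij.2 g)) := by
          refine sum_le_sum fun d _ => ?_
          rw [coeff_mul]
          calc r ^ d * p (∑ ij ∈ antidiagonal d, coeff ij.1 f * coeff ij.2 g)
              ≤ r ^ d * ∑ ij ∈ antidiagonal d, p (coeff ij.1 f * coeff ij.2 g) := by
                refine mul_le_mul_of_nonneg_left ?_ (pow_nonneg hr d)
                exact le_sum_of_subadditive p (map_zero p).le (map_add_le_add p) _ _
            _ ≤ _ := by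
                rw [mul_sum]
                refine sum_le_sum fun ij hij => ?_
                rw [← HasAntidiagonal.mem_antidiagonal.1 hij, pow_add]
                have := mul_le_mul_of_nonneg_left (map_mul_le_mul p (coeff ij.1 f) (coeff ij.2 g))
                  (mul_nonneg (pow_nonneg hr ij.1) (pow_nonneg hr ij.2))
                linarith
      _ = ∑ x ∈ (range D).sigma fun d => antidiagonal d,
            (r ^ x.2.1 * p (coeff x.2.1 f)) * (r ^ x.2.2 * p (coeff x.2.2 g)) := by
          rw [sum_sigma]
      _ = ∑ ij ∈ ((range D).sigma fun d => antidiagonal d).image (fun x => x.2),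
            (r ^ ij.1 * p (coeff ij.1 f)) * (r ^ ij.2 * p (coeff ij.2 g)) := by
          rw [sum_image]
          rintro ⟨a, b⟩ ha ⟨c, d⟩ hc h
          simp only [coe_sigma, Set.mem_sigma_iff, mem_coe, HasAntidiagonal.mem_antidiagonal] at ha hc h
          obtain rfl : b = d := h
          obtain rfl : a = c := ha.2.symm.trans hc.2
          rfl
      _ ≤ ∑ ij ∈ range D ×ˢ range D,
            (r ^ ij.1 * p (coeff ij.1 f)) * (r ^ ij.2 * p (coeff ij.2 g)) := by
          refine sum_le_sum_of_subset_of_nonneg ?_ fun ij _ _ => mul_nonneg (h0 f _) (h0 g _)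
          intro ij hij
          simp only [mem_image, mem_sigma, mem_range, HasAntidiagonal.mem_antidiagonal, Sigma.exists] at hij
          obtain ⟨a, b, ⟨h1, h2⟩, rfl⟩ := hij
          simp only [mem_product, mem_range]
          omega
      _ = _ := by rw [sum_product, sum_mul_sum]

lemma truncSeminorm_apply {B : Type*} [CommRing B] (p : RingSeminorm B) (r : ℝ) (hr : 0 ≤ r)
    (D : ℕ) (f : B⟦X⟧) : truncSeminorm p r hr D f = ∑ d ∈ range D, r ^ d * p (coeff d f) := rfl

lemma truncSeminorm_C_le {B : Type*} [CommRing B] (p : RingSeminorm B) (r : ℝ) (hr : 0 ≤ r)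
    (D : ℕ) (b : B) : truncSeminorm p r hr D (C b) ≤ p b := by
  rw [truncSeminorm_apply]
  cases D with
  | zero => simp
  | succ D =>
    rw [sum_range_succ']
    simp [coeff_C]

lemma truncSeminorm_X_le {B : Type*} [CommRing B] (p : RingSeminorm B) (hp : p 1 ≤ 1) (r : ℝ)
    (hr : 0 ≤ r) (D : ℕ) : truncSeminorm p r hr D X ≤ r := by
  rw [truncSeminorm_apply]
  calc ∑ d ∈ range D, r ^ d * p (coeff d (X : B⟦X⟧))
      ≤ ∑ d ∈ range D, if d = 1 then r else 0 := by
        refine sum_le_sum fun d _ => ?_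
        rw [coeff_X]
        split_ifs with h
        · subst h; simpa using mul_le_mul_of_nonneg_left hp hr
        · simp
    _ ≤ r := by
        rw [sum_ite_eq']
        split_ifs <;> simp [hr]

lemma le_truncSeminorm {B : Type*} [CommRing B] (p : RingSeminorm B) (r : ℝ) (hr : 0 ≤ r)
    {d D : ℕ} (h : d < D) (f : B⟦X⟧) : r ^ d * p (coeff d f) ≤ truncSeminorm p r hr D f :=
  single_le_sum (f := fun d => r ^ d * p (coeff d f))
    (fun i _ => mul_nonneg (pow_nonneg hr i) (apply_nonneg p _)) (mem_range.2 h)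

/-- The weighted `ℓ¹` seminorm of the terms of degree below `D` in both variables. -/
noncomputable def biSeminorm {r : ℝ} (hr : 0 < r) (D : ℕ) : RingSeminorm ℂ⟦X⟧⟦X⟧ :=
  truncSeminorm (truncSeminorm (normRingSeminorm ℂ) r hr.le D) (1 / 16) (by norm_num) D

section Bounds
variable {r : ℝ} (hr : 0 < r)

lemma norm_coeff_le_biSeminorm {a d D : ℕ} (ha : a < D) (hd : d < D) (f : ℂ⟦X⟧⟦X⟧) :
    ‖coeff d (coeff a f)‖ ≤ ((1 / 16) ^ a * r ^ d)⁻¹ * biSeminorm hr D f := by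
  have h1 := le_truncSeminorm (truncSeminorm (normRingSeminorm ℂ) r hr.le D) (1 / 16)
    (by norm_num) ha f
  have h2 := le_truncSeminorm (normRingSeminorm ℂ) r hr.le hd (coeff a f)
  have h3 : normRingSeminorm ℂ (coeff d (coeff a f)) = ‖coeff d (coeff a f)‖ := rfl
  rw [h3] at h2
  have hpos : (0 : ℝ) < (1 / 16) ^ a * r ^ d := by positivity
  rw [inv_mul_eq_div, le_div_iff₀ hpos]
  have h4 := mul_le_mul_of_nonneg_left h2 (show (0 : ℝ) ≤ (1 / 16) ^ a by positivity)
  exact (le_of_eq (by ring)).trans (h4.trans h1)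

lemma norm_coeff_le_of_biSeminorm_le {a d : ℕ} {f : ℂ⟦X⟧⟦X⟧} {u : ℝ}
    (h : ∀ D, biSeminorm hr D f ≤ u) :
    ‖coeff d (coeff a f)‖ ≤ ((1 / 16) ^ a * r ^ d)⁻¹ * u :=
  (norm_coeff_le_biSeminorm hr (D := a + d + 1) (by omega) (by omega) f).trans
    (mul_le_mul_of_nonneg_left (h _) (by positivity))

lemma summable_of_biSeminorm_le {α : Type*} {f : α → ℂ⟦X⟧⟦X⟧} {u : α → ℝ} (hu : Summable u)
    (h : ∀ D i, biSeminorm hr D (f i) ≤ u i) : Summable f := by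
  rw [WithPiTopology.summable_iff_summable_coeff]
  intro a
  rw [WithPiTopology.summable_iff_summable_coeff]
  intro d
  exact Summable.of_norm_bounded (hu.mul_left _)
    fun i => norm_coeff_le_of_biSeminorm_le hr fun D => h D i

lemma tendsto_iff_coeff_coeff {α : Type*} {l : Filter α} {f : α → ℂ⟦X⟧⟦X⟧} {g : ℂ⟦X⟧⟦X⟧} :
    Tendsto f l (𝓝 g) ↔
      ∀ a d, Tendsto (fun i => coeff d (coeff a (f i))) l (𝓝 (coeff d (coeff a g))) := by
  simp only [WithPiTopology.tendsto_iff_coeff_tendsto]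

lemma hasSum_coeff_coeff {α : Type*} {f : α → ℂ⟦X⟧⟦X⟧} {g : ℂ⟦X⟧⟦X⟧} (h : HasSum f g) (a d : ℕ) :
    HasSum (fun i => coeff d (coeff a (f i))) (coeff d (coeff a g)) := by
  rw [WithPiTopology.hasSum_iff_hasSum_coeff] at h
  have := h a
  rw [WithPiTopology.hasSum_iff_hasSum_coeff] at this
  exact this d

lemma tendsto_zero_of_biSeminorm_le {f : ℕ → ℂ⟦X⟧⟦X⟧} {u : ℕ → ℝ} (hu : Tendsto u atTop (𝓝 0))
    (h : ∀ D i, biSeminorm hr D (f i) ≤ u i) : Tendsto f atTop (𝓝 0) := by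
  rw [tendsto_iff_coeff_coeff]
  intro a d
  have h2 := hu.const_mul ((1 / 16) ^ a * r ^ d)⁻¹
  rw [mul_zero] at h2
  simpa using squeeze_zero_norm (fun i => norm_coeff_le_of_biSeminorm_le hr fun D => h D i) h2

lemma tendsto_tsum_of_biSeminorm_le {f : ℕ → ℕ → ℂ⟦X⟧⟦X⟧} {g : ℕ → ℂ⟦X⟧⟦X⟧} {u : ℕ → ℝ}
    (hu : Summable u) (h : ∀ D n k, biSeminorm hr D (f n k) ≤ u k)
    (hg : ∀ k, Tendsto (fun n => f n k) atTop (𝓝 (g k))) (hgs : Summable g) :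
    Tendsto (fun n => ∑' k, f n k) atTop (𝓝 (∑' k, g k)) := by
  rw [tendsto_iff_coeff_coeff]
  intro a d
  have h1 : ∀ n, coeff d (coeff a (∑' k, f n k)) = ∑' k, coeff d (coeff a (f n k)) := fun n =>
    ((hasSum_coeff_coeff (summable_of_biSeminorm_le hr hu fun D k => h D n k).hasSum
      a d).tsum_eq).symm
  have h2 := (hasSum_coeff_coeff hgs.hasSum a d).tsum_eq
  simp only [h1, ← h2]
  exact tendsto_tsum_of_dominated_convergence (hu.mul_left _)
    (fun k => tendsto_iff_coeff_coeff.1 (hg k) a d)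
    (Eventually.of_forall fun n k => norm_coeff_le_of_biSeminorm_le hr fun D => h D n k)

lemma biSeminorm_X_le (D : ℕ) : biSeminorm hr D X ≤ 1 / 16 := by
  refine truncSeminorm_X_le _ ?_ _ (by norm_num) D
  have := truncSeminorm_C_le (normRingSeminorm ℂ) r hr.le D 1
  rw [map_one] at this
  exact this.trans (norm_one (α := ℂ)).le

lemma biSeminorm_C_C_le (D : ℕ) (c : ℂ) : biSeminorm hr D (C (C c)) ≤ ‖c‖ :=
  (truncSeminorm_C_le _ _ _ _ _).trans (truncSeminorm_C_le (normRingSeminorm ℂ) r hr.le D c)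

lemma biSeminorm_natCast_le (D n : ℕ) : biSeminorm hr D n ≤ n := by
  simpa using biSeminorm_C_C_le hr D n

lemma biSeminorm_one_le (D : ℕ) : biSeminorm hr D 1 ≤ 1 := by
  simpa using biSeminorm_natCast_le hr D 1

lemma biSeminorm_C_C_mul_X_le (D : ℕ) (c : ℂ) : biSeminorm hr D (C (C c * X)) ≤ ‖c‖ * r := by
  rw [map_mul]
  refine (map_mul_le_mul _ _ _).trans (mul_le_mul (biSeminorm_C_C_le hr D c) ?_
    (apply_nonneg _ _) (norm_nonneg c))
  refine (truncSeminorm_C_le _ _ _ _ _).trans (truncSeminorm_X_le (normRingSeminorm ℂ) ?_ r hr.le D)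
  exact (norm_one (α := ℂ)).le

end Bounds

/-- The real majorant `∏_{j < n} (1 + 1 / (8 (j + 1)))`. -/
noncomputable def majorant (n : ℕ) : ℝ := ∏ j ∈ range n, (1 + 1 / (8 * ((j : ℝ) + 1)))

lemma majorant_succ (n : ℕ) : majorant (n + 1) = majorant n * (1 + 1 / (8 * ((n : ℝ) + 1))) := by
  rw [majorant, prod_range_succ, majorant]

lemma one_le_majorant (n : ℕ) : 1 ≤ majorant n := by
  induction n with
  | zero => simp [majorant]
  | succ n ih =>
    rw [majorant_succ]
    exact one_le_mul_of_one_le_of_one_le ih (le_add_of_nonneg_right (by positivity))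

lemma majorant_le_succ (n : ℕ) : majorant n ≤ majorant (n + 1) := by
  have h := one_le_majorant n
  have : (0 : ℝ) ≤ 1 / (8 * ((n : ℝ) + 1)) := by positivity
  rw [majorant_succ]
  nlinarith

lemma majorant_pow_four_le (n : ℕ) : majorant n ^ 4 ≤ n + 1 := by
  induction n with
  | zero => simp [majorant]
  | succ n ih =>
    rw [majorant_succ, mul_pow]
    have h0 : (0 : ℝ) < (n : ℝ) + 1 := by positivity
    set t : ℝ := 1 / ((n : ℝ) + 1) with ht
    have ht0 : 0 < t := by positivity
    have ht1 : t ≤ 1 := by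
      rw [ht, div_le_one h0]
      linarith [(Nat.cast_nonneg n : (0 : ℝ) ≤ n)]
    have h1 : 1 / (8 * ((n : ℝ) + 1)) = t / 8 := by rw [ht]; field_simp
    have h2 : (1 + t / 8) ^ 4 ≤ 1 + t := by
      have h3 : t ^ 2 ≤ t := by nlinarith
      have h4 : t ^ 3 ≤ t := by nlinarith
      have h5 : t ^ 4 ≤ t := by nlinarith
      nlinarith
    rw [h1]
    calc majorant n ^ 4 * (1 + t / 8) ^ 4 ≤ (n + 1) * (1 + t) :=
          mul_le_mul ih h2 (by positivity) h0.le
      _ = ((n + 1 : ℕ) : ℝ) + 1 := by rw [ht]; push_cast; field_simp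

lemma majorant_sq_le (n : ℕ) : majorant n ^ 2 ≤ ((n : ℝ) + 1) ^ (1 / 2 : ℝ) := by
  rw [← Real.sqrt_eq_rpow]
  refine Real.le_sqrt_of_sq_le ?_
  rw [← pow_mul]
  exact majorant_pow_four_le n

lemma majorant_le_sq (n : ℕ) : majorant n ≤ majorant n ^ 2 := by
  nlinarith [one_le_majorant n]

lemma summable_majorant : Summable fun n : ℕ => majorant n ^ 2 / ((n : ℝ) + 1) ^ 2 := by
  have h : Summable fun n : ℕ => (((n + 1 : ℕ) : ℝ)) ^ (-(3 / 2) : ℝ) :=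
    (summable_nat_add_iff 1).2 (Real.summable_nat_rpow.2 (by norm_num))
  refine Summable.of_nonneg_of_le (fun n => by positivity) (fun n => ?_) h
  have h0 : (0 : ℝ) < (n : ℝ) + 1 := by positivity
  rw [div_le_iff₀ (by positivity)]
  refine (majorant_sq_le n).trans (le_of_eq ?_)
  push_cast
  rw [← Real.rpow_natCast ((n : ℝ) + 1) 2, ← Real.rpow_add h0]
  norm_num

lemma tendsto_majorant_div : Tendsto (fun n : ℕ => majorant n / ((n : ℝ) + 1)) atTop (𝓝 0) := by
  have h : Tendsto (fun n : ℕ => (((n + 1 : ℕ) : ℝ)) ^ (-(1 / 2) : ℝ)) atTop (𝓝 0) :=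
    ((tendsto_rpow_neg_atTop (by norm_num : (0 : ℝ) < 1 / 2)).comp
      tendsto_natCast_atTop_atTop).comp (tendsto_add_atTop_nat 1)
  have hm := one_le_majorant
  refine squeeze_zero (fun n => div_nonneg (by linarith [hm n]) (by positivity)) (fun n => ?_) h
  have h0 : (0 : ℝ) < (n : ℝ) + 1 := by positivity
  rw [div_le_iff₀ h0]
  refine ((majorant_le_sq n).trans (majorant_sq_le n)).trans (le_of_eq ?_)
  push_cast
  nth_rewrite 3 [← Real.rpow_one ((n : ℝ) + 1)]
  rw [← Real.rpow_add h0]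
  norm_num

section Bounds
variable {r : ℝ} (hr : 0 < r)

/-- The constant `1 / (n + 1)`. -/
noncomputable def recip (n : ℕ) : ℂ⟦X⟧⟦X⟧ := C (C (1 / ((n : ℂ) + 1)))

lemma recip_mul (n : ℕ) : recip n * ((n : ℂ⟦X⟧⟦X⟧) + 1) = 1 := by
  have h : (C (C ((n : ℂ) + 1)) : ℂ⟦X⟧⟦X⟧) = n + 1 := by simp
  rw [recip, ← h, ← map_mul, ← map_mul, one_div_mul_cancel (Nat.cast_add_one_ne_zero n)]
  simp

lemma biSeminorm_recip_le (D n : ℕ) : biSeminorm hr D (recip n) ≤ 1 / ((n : ℝ) + 1) := by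
  refine (biSeminorm_C_C_le hr D _).trans (le_of_eq ?_)
  rw [norm_div, norm_one, ← Nat.cast_add_one, Complex.norm_natCast]
  push_cast
  rfl

lemma biSeminorm_inverse_le {D n : ℕ} {x i : ℂ⟦X⟧⟦X⟧} (hx : biSeminorm hr D x ≤ 1 / 2)
    (hi : i * ((n : ℂ⟦X⟧⟦X⟧) + 1 - x) = 1) : biSeminorm hr D i ≤ 2 / ((n : ℝ) + 1) := by
  set p := biSeminorm hr D
  have h : i = recip n * (1 + x * i) := by
    linear_combination recip n * hi - i * recip_mul n
  have hn : 0 ≤ p i := apply_nonneg _ _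
  have h1 : p i ≤ 1 / ((n : ℝ) + 1) * (1 + 1 / 2 * p i) := by
    calc p i = p (recip n * (1 + x * i)) := by rw [← h]
      _ ≤ p (recip n) * p (1 + x * i) := map_mul_le_mul p _ _
      _ ≤ 1 / ((n : ℝ) + 1) * (1 + 1 / 2 * p i) := by
        refine mul_le_mul (biSeminorm_recip_le hr D n) ?_ (apply_nonneg p _) (by positivity)
        refine (map_add_le_add p _ _).trans (add_le_add (biSeminorm_one_le hr D) ?_)
        exact (map_mul_le_mul p _ _).trans (mul_le_mul_of_nonneg_right hx hn)
  have h0 : (1 : ℝ) ≤ (n : ℝ) + 1 := by linarith [(Nat.cast_nonneg n : (0 : ℝ) ≤ n)]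
  rw [le_div_iff₀ (by linarith)]
  rw [one_div_mul_eq_div, le_div_iff₀ (by linarith)] at h1
  nlinarith

lemma biSeminorm_prod_le {D : ℕ} {α : Type*} (s : Finset α) (f : α → ℂ⟦X⟧⟦X⟧) (u : α → ℝ)
    (h : ∀ i ∈ s, biSeminorm hr D (f i) ≤ u i) :
    biSeminorm hr D (∏ i ∈ s, f i) ≤ ∏ i ∈ s, u i := by
  classical
  induction s using Finset.induction_on with
  | empty => simpa using biSeminorm_one_le hr D
  | insert a s ha ih =>
    rw [prod_insert ha, prod_insert ha]
    exact (map_mul_le_mul _ _ _).trans (mul_le_mul (h a (mem_insert_self a s))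
      (ih fun i hi => h i (mem_insert_of_mem hi)) (apply_nonneg _ _)
      ((apply_nonneg (biSeminorm hr D) _).trans (h a (mem_insert_self a s))))

lemma biSeminorm_risingProd_le {D : ℕ} {w : ℂ⟦X⟧⟦X⟧} {ι : ℕ → ℂ⟦X⟧⟦X⟧}
    (hw : biSeminorm hr D w ≤ 1 / 16) (hι : ∀ n, biSeminorm hr D (ι n) ≤ 2 / ((n : ℝ) + 1))
    (n : ℕ) : biSeminorm hr D (risingProd w ι n) ≤ majorant n := by
  refine biSeminorm_prod_le hr _ _ _ fun j _ => ?_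
  refine (map_add_le_add _ _ _).trans (add_le_add (biSeminorm_one_le hr D) ?_)
  refine (map_mul_le_mul _ _ _).trans ((mul_le_mul hw (hι j) (apply_nonneg _ _)
    (by norm_num)).trans (le_of_eq ?_))
  field_simp
  norm_num

end Bounds

section Limits
variable {r : ℝ} (hr : 0 < r)

/-- The coefficients of the product of `risingSeries w ι` and `risingSeries (-w) recip`. -/
noncomputable def ratioCoeff (w : ℂ⟦X⟧⟦X⟧) (ι : ℕ → ℂ⟦X⟧⟦X⟧) (k : ℕ) : ℂ⟦X⟧⟦X⟧ :=
  coeff k (risingSeries w ι * risingSeries (-w) recip)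

lemma ratioCoeff_zero (w : ℂ⟦X⟧⟦X⟧) (ι : ℕ → ℂ⟦X⟧⟦X⟧) : ratioCoeff w ι 0 = 1 := by
  simp [ratioCoeff, risingSeries, risingCoeff]

lemma ratioCoeff_succ {w x : ℂ⟦X⟧⟦X⟧} {ι : ℕ → ℂ⟦X⟧⟦X⟧}
    (hι : ∀ n, ι n * ((n : ℂ⟦X⟧⟦X⟧) + 1 - x) = 1) (k : ℕ) :
    ratioCoeff w ι (k + 1) = x * ι k * (w * recip k * risingProd (-w) recip k) := by
  have h := coeff_risingSeries_mul (w := w) hι (κ := recip) (y := 0)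
    (by simpa using recip_mul) (k + 1)
  rw [risingCoeff] at h
  push_cast at h
  rw [ratioCoeff]
  linear_combination ι k * h
    - coeff (k + 1) (risingSeries w ι * risingSeries (-w) recip) * hι k

lemma biSeminorm_ratioCoeff_le {D : ℕ} {w x : ℂ⟦X⟧⟦X⟧} {ι : ℕ → ℂ⟦X⟧⟦X⟧}
    (hw : biSeminorm hr D w ≤ 1 / 16) (hx : biSeminorm hr D x ≤ 1 / 2)
    (hι : ∀ n, ι n * ((n : ℂ⟦X⟧⟦X⟧) + 1 - x) = 1) (k : ℕ) :
    biSeminorm hr D (ratioCoeff w ι k) ≤ 4 * (majorant k / ((k : ℝ) + 1) ^ 2) := by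
  cases k with
  | zero =>
    rw [ratioCoeff_zero]
    refine (biSeminorm_one_le hr D).trans ?_
    simp [majorant]
  | succ k =>
    rw [ratioCoeff_succ hι]
    set p := biSeminorm hr D
    have h0 : (0 : ℝ) ≤ k := Nat.cast_nonneg k
    have h2 : p (risingProd (-w) recip k) ≤ majorant k := by
      refine biSeminorm_risingProd_le hr ((map_neg_eq_map p w).trans_le hw) (fun n => ?_) k
      refine (biSeminorm_recip_le hr D n).trans ?_
      gcongr
      norm_num
    have hm := one_le_majorant k
    calc p (x * ι k * (w * recip k * risingProd (-w) recip k))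
        ≤ (1 / 2 * (2 / ((k : ℝ) + 1))) * ((1 / 16 * (1 / ((k : ℝ) + 1))) * majorant k) := by
          refine (map_mul_le_mul p _ _).trans (mul_le_mul ?_ ?_ (apply_nonneg p _) (by positivity))
          · exact (map_mul_le_mul p _ _).trans (mul_le_mul hx (biSeminorm_inverse_le hr hx (hι k))
              (apply_nonneg p _) (by norm_num))
          · refine (map_mul_le_mul p _ _).trans (mul_le_mul ?_ h2 (apply_nonneg p _)
              (by positivity))
            exact (map_mul_le_mul p _ _).trans (mul_le_mul hw (biSeminorm_recip_le hr D k)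
              (apply_nonneg p _) (by norm_num))
      _ = 1 / 16 * (majorant k / ((k : ℝ) + 1) ^ 2) := by field_simp
      _ ≤ 4 * (majorant (k + 1) / (((k + 1 : ℕ) : ℝ) + 1) ^ 2) := by
          push_cast
          rw [← mul_div_assoc, ← mul_div_assoc, div_le_div_iff₀ (by positivity) (by positivity)]
          have h3 := majorant_le_succ k
          calc 1 / 16 * majorant k * ((k : ℝ) + 1 + 1) ^ 2
              ≤ 1 / 16 * majorant (k + 1) * (2 * ((k : ℝ) + 1)) ^ 2 := by
                gcongr <;> linarith
            _ ≤ 4 * majorant (k + 1) * ((k : ℝ) + 1) ^ 2 := by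
                have : 0 ≤ majorant (k + 1) * ((k : ℝ) + 1) ^ 2 :=
                  mul_nonneg (by linarith) (by positivity)
                nlinarith

lemma ratioBound_le (k : ℕ) :
    4 * (majorant k / ((k : ℝ) + 1) ^ 2) ≤ 4 * (majorant k ^ 2 / ((k : ℝ) + 1) ^ 2) := by
  have := majorant_le_sq k
  gcongr

lemma summable_ratioCoeff {w x : ℂ⟦X⟧⟦X⟧} {ι : ℕ → ℂ⟦X⟧⟦X⟧}
    (hw : ∀ D, biSeminorm hr D w ≤ 1 / 16) (hx : ∀ D, biSeminorm hr D x ≤ 1 / 2)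
    (hι : ∀ n, ι n * ((n : ℂ⟦X⟧⟦X⟧) + 1 - x) = 1) : Summable (ratioCoeff w ι) :=
  summable_of_biSeminorm_le hr (summable_majorant.mul_left 4) fun D k =>
    (biSeminorm_ratioCoeff_le hr (hw D) (hx D) hι k).trans (ratioBound_le k)

lemma hasSum_coeff_risingSeries_mul {w x y : ℂ⟦X⟧⟦X⟧} {ι κ : ℕ → ℂ⟦X⟧⟦X⟧}
    (hw : ∀ D, biSeminorm hr D w ≤ 1 / 16) (hx : ∀ D, biSeminorm hr D x ≤ 1 / 2)
    (hy : ∀ D, biSeminorm hr D y ≤ 1 / 2)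
    (hι : ∀ n, ι n * ((n : ℂ⟦X⟧⟦X⟧) + 1 - x) = 1) (hκ : ∀ n, κ n * ((n : ℂ⟦X⟧⟦X⟧) + 1 - y) = 1) :
    HasSum (fun n => coeff n (risingSeries w ι * risingSeries (-w) κ))
      ((∑' k, ratioCoeff w ι k) * ∑' k, ratioCoeff (-w) κ k) := by
  have hw' : ∀ D, biSeminorm hr D (-w) ≤ 1 / 16 := fun D => (map_neg_eq_map _ w).trans_le (hw D)
  have h1 := summable_ratioCoeff hr hw hx hι
  have h2 := summable_ratioCoeff hr hw' hy hκ
  have hb : Summable fun ij : ℕ × ℕ => (4 * (majorant ij.1 ^ 2 / ((ij.1 : ℝ) + 1) ^ 2))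
      * (4 * (majorant ij.2 ^ 2 / ((ij.2 : ℝ) + 1) ^ 2)) :=
    (summable_majorant.mul_left 4).mul_of_nonneg (summable_majorant.mul_left 4)
      (fun _ => by positivity) (fun _ => by positivity)
  have h3 : Summable fun ij : ℕ × ℕ => ratioCoeff w ι ij.1 * ratioCoeff (-w) κ ij.2 := by
    refine summable_of_biSeminorm_le hr hb fun D ij => ?_
    exact (map_mul_le_mul _ _ _).trans (mul_le_mul
      ((biSeminorm_ratioCoeff_le hr (hw D) (hx D) hι _).trans (ratioBound_le _))
      ((biSeminorm_ratioCoeff_le hr (hw' D) (hy D) hκ _).trans (ratioBound_le _))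
      (apply_nonneg _ _) (by positivity))
  rw [h1.tsum_mul_tsum_eq_tsum_sum_antidiagonal h2 h3]
  refine (summable_sum_mul_antidiagonal_of_summable_mul h3).hasSum.congr_fun fun n => ?_
  have hs : risingSeries w ι * risingSeries (-w) κ
      = risingSeries w ι * risingSeries (-w) recip
        * (risingSeries (-w) κ * risingSeries (- -w) recip) := by
    rw [neg_neg]
    linear_combination (-(risingSeries w ι * risingSeries (-w) κ))
      * risingSeries_mul_neg (w := w) recip_mul
  rw [hs, coeff_mul]
  rfl

lemma tendsto_risingProd_mul_prod {w x : ℂ⟦X⟧⟦X⟧} {ι e : ℕ → ℂ⟦X⟧⟦X⟧}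
    (hw : ∀ D, biSeminorm hr D w ≤ 1 / 16) (hx : ∀ D, biSeminorm hr D x ≤ 1 / 2)
    (hι : ∀ n, ι n * ((n : ℂ⟦X⟧⟦X⟧) + 1 - x) = 1) (he : ∀ n, e n * (1 + w * recip n) = 1) :
    Tendsto (fun n => risingProd w ι n * ∏ i ∈ range n, e i) atTop
      (𝓝 (∑' k, ratioCoeff w ι k)) := by
  have heb : ∀ D n, biSeminorm hr D (e n) ≤ 1 + 1 / (8 * ((n : ℝ) + 1)) := by
    intro D n
    set p := biSeminorm hr D
    have h1 : p (e n) ≤ 1 + 1 / 16 * (1 / ((n : ℝ) + 1)) * p (e n) := by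
      have h : e n = 1 + -(w * recip n * e n) := by linear_combination he n
      calc p (e n) = p (1 + -(w * recip n * e n)) := by rw [← h]
        _ ≤ p 1 + p (w * recip n * e n) := by
          rw [← map_neg_eq_map p (w * recip n * e n)]
          exact map_add_le_add p _ _
        _ ≤ 1 + 1 / 16 * (1 / ((n : ℝ) + 1)) * p (e n) := by
          refine add_le_add (biSeminorm_one_le hr D) ((map_mul_le_mul p _ _).trans
            (mul_le_mul_of_nonneg_right ?_ (apply_nonneg p _)))
          exact (map_mul_le_mul p _ _).trans (mul_le_mul (hw D) (biSeminorm_recip_le hr D n)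
            (apply_nonneg p _) (by norm_num))
    have h0 : (1 : ℝ) ≤ (n : ℝ) + 1 := by linarith [(Nat.cast_nonneg n : (0 : ℝ) ≤ n)]
    set t : ℝ := 1 / ((n : ℝ) + 1) with ht
    have ht0 : 0 < t := by positivity
    have ht1 : t ≤ 1 := by rwa [ht, div_le_one (by linarith)]
    have h2 : 1 / (8 * ((n : ℝ) + 1)) = t / 8 := by rw [ht]; field_simp
    rw [h2]
    have h3 : p (e n) ≤ 2 := by nlinarith [apply_nonneg p (e n)]
    nlinarith
  have he1 : Tendsto e atTop (𝓝 1) := by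
    have h : Tendsto (fun n => e n - 1) atTop (𝓝 0) := by
      have hu : Tendsto (fun n : ℕ => 1 / ((n : ℝ) + 1)) atTop (𝓝 0) :=
        tendsto_one_div_add_atTop_nhds_zero_nat
      refine tendsto_zero_of_biSeminorm_le hr hu fun D n => ?_
      have h : e n - 1 = -(w * recip n * e n) := by linear_combination he n
      have h0 : (1 : ℝ) ≤ (n : ℝ) + 1 := by linarith [(Nat.cast_nonneg n : (0 : ℝ) ≤ n)]
      have h2 : biSeminorm hr D (e n) ≤ 2 := by
        refine (heb D n).trans ?_
        have : 1 / (8 * ((n : ℝ) + 1)) ≤ 1 := by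
          rw [div_le_one (by linarith)]; linarith
        linarith
      rw [h, map_neg_eq_map]
      calc biSeminorm hr D (w * recip n * e n)
          ≤ 1 / 16 * (1 / ((n : ℝ) + 1)) * 2 := by
            refine (map_mul_le_mul _ _ _).trans (mul_le_mul ?_ h2 (apply_nonneg _ _)
              (by positivity))
            exact (map_mul_le_mul _ _ _).trans (mul_le_mul (hw D) (biSeminorm_recip_le hr D n)
              (apply_nonneg _ _) (by norm_num))
        _ ≤ 1 / ((n : ℝ) + 1) := by
            have : 0 < 1 / ((n : ℝ) + 1) := by positivity
            linarith
    simpa using h.add_const 1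
  set f : ℕ → ℕ → ℂ⟦X⟧⟦X⟧ := fun n k =>
    if k ≤ n then ratioCoeff w ι k * ∏ i ∈ range k, e (n - k + i) else 0 with hf
  have hmain : ∀ n, risingProd w ι n * ∏ i ∈ range n, e i = ∑' k, f n k := by
    intro n
    rw [tsum_eq_sum (s := range (n + 1)) fun k hk => by
      simp only [hf]; rw [if_neg]; simpa [Nat.lt_succ_iff] using hk,
      risingProd_eq_sum w ι recip recip_mul, sum_mul]
    refine sum_congr rfl fun k hk => ?_
    have hkn : k ≤ n := Nat.lt_succ_iff.1 (mem_range.1 hk)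
    simp only [hf]
    rw [if_pos hkn, ← ratioCoeff, mul_assoc]
    congr 1
    obtain ⟨m, rfl⟩ := Nat.exists_eq_add_of_le' hkn
    rw [Nat.add_sub_cancel, prod_range_add, ← mul_assoc, risingProd, ← prod_mul_distrib,
      prod_eq_one fun i _ => by rw [mul_comm]; exact he i, one_mul]
  simp only [hmain]
  have hu : Summable fun k : ℕ => 4 * (majorant k ^ 2 / ((k : ℝ) + 1) ^ 2) :=
    summable_majorant.mul_left 4
  refine tendsto_tsum_of_biSeminorm_le hr hu (fun D n k => ?_) (fun k => ?_)
    (summable_ratioCoeff hr hw hx hι)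
  · have hm := one_le_majorant k
    simp only [hf]
    split_ifs with hk
    · have h1 : biSeminorm hr D (∏ i ∈ range k, e (n - k + i)) ≤ majorant k := by
        refine biSeminorm_prod_le hr _ _ _ fun i _ => (heb D _).trans ?_
        gcongr
        omega
      refine (map_mul_le_mul _ _ _).trans ((mul_le_mul (biSeminorm_ratioCoeff_le hr (hw D) (hx D)
        hι k) h1 (apply_nonneg _ _) (by positivity)).trans (le_of_eq (by ring)))
    · rw [map_zero]
      positivity
  · have h1 : Tendsto (fun n => ratioCoeff w ι k * ∏ i ∈ range k, e (n - k + i)) atTop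
        (𝓝 (ratioCoeff w ι k * ∏ i ∈ range k, 1)) :=
      tendsto_const_nhds.mul (tendsto_finsetProd _ fun i _ =>
        he1.comp (tendsto_atTop_mono (fun n => Nat.le_add_right (n - k) i) (tendsto_sub_atTop_nat k)))
    rw [prod_const_one, mul_one] at h1
    refine h1.congr' ?_
    filter_upwards [eventually_ge_atTop k] with n hn
    simp only [hf]
    rw [if_pos hn]

end Limits

section SumFormula
variable {r : ℝ} (hr : 0 < r)

lemma biSeminorm_shiftedProd_le {D : ℕ} {y z : ℂ⟦X⟧⟦X⟧} {ι : ℕ → ℂ⟦X⟧⟦X⟧}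
    (hy : biSeminorm hr D y ≤ 1 / 2) (hz : biSeminorm hr D z ≤ 1 / 16)
    (hι : ∀ n, ι n * ((n : ℂ⟦X⟧⟦X⟧) + 1 - y) = 1) (n N : ℕ) :
    biSeminorm hr D (shiftedProd y z ι n N) ≤ 2 / ((N : ℝ) + n + 1) * majorant N := by
  set p := biSeminorm hr D
  have hιb : ∀ n, p (ι n) ≤ 2 / ((n : ℝ) + 1) := fun n => biSeminorm_inverse_le hr hy (hι n)
  refine (map_mul_le_mul p _ _).trans (mul_le_mul ?_ ?_ (apply_nonneg p _) (by positivity))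
  · simpa using hιb (N + n)
  refine biSeminorm_prod_le hr _ _ _ fun j _ => ?_
  have hm : (0 : ℝ) < (j : ℝ) + n + 1 := by positivity
  have h1 := hιb (j + n)
  have h2 := biSeminorm_recip_le hr D (j + n)
  have h3 := recip_mul (j + n)
  have h4 := hι (j + n)
  push_cast at h1 h2 h3 h4
  have h : ((j : ℂ⟦X⟧⟦X⟧) + 1 - y + z) * ι (j + n)
      = recip (j + n) * ((j + 1 : ℕ) : ℂ⟦X⟧⟦X⟧)
        + -((n : ℂ⟦X⟧⟦X⟧) * (y * (recip (j + n) * ι (j + n)))) + z * ι (j + n) := by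
    push_cast
    linear_combination (1 - recip (j + n) * (n : ℂ⟦X⟧⟦X⟧)) * h4
      + ((n : ℂ⟦X⟧⟦X⟧) * ι (j + n) - 1) * h3
  have ha : p (recip (j + n) * ((j + 1 : ℕ) : ℂ⟦X⟧⟦X⟧))
      ≤ 1 / ((j : ℝ) + n + 1) * ((j : ℝ) + 1) := by
    refine (map_mul_le_mul p _ _).trans (mul_le_mul h2 ?_ (apply_nonneg p _) (by positivity))
    exact_mod_cast biSeminorm_natCast_le hr D (j + 1)
  have hb : p ((n : ℂ⟦X⟧⟦X⟧) * (y * (recip (j + n) * ι (j + n))))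
      ≤ n * (1 / 2 * (1 / ((j : ℝ) + n + 1) * (2 / ((j : ℝ) + n + 1)))) := by
    refine (map_mul_le_mul p _ _).trans (mul_le_mul (biSeminorm_natCast_le hr D n) ?_
      (apply_nonneg p _) (by positivity))
    refine (map_mul_le_mul p _ _).trans (mul_le_mul hy ?_ (apply_nonneg p _) (by norm_num))
    exact (map_mul_le_mul p _ _).trans (mul_le_mul h2 h1 (apply_nonneg p _) (by positivity))
  have hc : p (z * ι (j + n)) ≤ 1 / 16 * (2 / ((j : ℝ) + n + 1)) :=
    (map_mul_le_mul p _ _).trans (mul_le_mul hz h1 (apply_nonneg p _) (by norm_num))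
  rw [h]
  refine (map_add_le_add p _ _).trans (add_le_add ((map_add_le_add p _ _).trans ?_)
    (hc.trans ?_))
  · rw [map_neg_eq_map]
    refine (add_le_add ha hb).trans ?_
    have h0 : (1 : ℝ) ≤ (j : ℝ) + n + 1 := by
      have : (0 : ℝ) ≤ (j : ℝ) + n := by positivity
      linarith
    have hn : (0 : ℝ) ≤ n := Nat.cast_nonneg n
    have : 1 / ((j : ℝ) + n + 1) * ((j : ℝ) + 1)
        + n * (1 / 2 * (1 / ((j : ℝ) + n + 1) * (2 / ((j : ℝ) + n + 1))))
        = (((j : ℝ) + 1) * ((j : ℝ) + n + 1) + n) / ((j : ℝ) + n + 1) ^ 2 := by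
      field_simp
    rw [this, div_le_one (by positivity)]
    nlinarith
  · have hn : (0 : ℝ) ≤ n := Nat.cast_nonneg n
    rw [show (1 : ℝ) / 16 * (2 / ((j : ℝ) + n + 1)) = 1 / (8 * ((j : ℝ) + n + 1)) by
      field_simp; norm_num]
    gcongr
    linarith

lemma hasSum_recip_mul_shiftedProd {y z : ℂ⟦X⟧⟦X⟧} {ι ζ : ℕ → ℂ⟦X⟧⟦X⟧}
    (hy : ∀ D, biSeminorm hr D y ≤ 1 / 2) (hz : ∀ D, biSeminorm hr D z ≤ 1 / 16)
    (hι : ∀ n, ι n * ((n : ℂ⟦X⟧⟦X⟧) + 1 - y) = 1) (hζ : ∀ n, ζ n * ((n : ℂ⟦X⟧⟦X⟧) + 1 - z) = 1) :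
    HasSum (fun N => recip N * shiftedProd y z ι 0 N) (∑' n, ζ n * ι n) := by
  have hb : ∀ D n N, biSeminorm hr D (recip N * shiftedProd y z ι n N)
      ≤ 2 * (majorant N ^ 2 / ((N : ℝ) + 1) ^ 2) := by
    intro D n N
    have hm := one_le_majorant N
    calc biSeminorm hr D (recip N * shiftedProd y z ι n N)
        ≤ 1 / ((N : ℝ) + 1) * (2 / ((N : ℝ) + n + 1) * majorant N) :=
          (map_mul_le_mul _ _ _).trans (mul_le_mul (biSeminorm_recip_le hr D N)
            (biSeminorm_shiftedProd_le hr (hy D) (hz D) hι n N) (apply_nonneg _ _) (by positivity))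
      _ ≤ 1 / ((N : ℝ) + 1) * (2 / ((N : ℝ) + 1) * majorant N ^ 2) := by
          have h1 : (N : ℝ) + 1 ≤ (N : ℝ) + n + 1 := by
            linarith [(Nat.cast_nonneg n : (0 : ℝ) ≤ n)]
          have h2 := majorant_le_sq N
          gcongr
      _ = _ := by field_simp
  have hu : Summable fun N : ℕ => 2 * (majorant N ^ 2 / ((N : ℝ) + 1) ^ 2) :=
    summable_majorant.mul_left 2
  have hs : ∀ n, Summable fun N => recip N * shiftedProd y z ι n N := fun n =>
    summable_of_biSeminorm_le hr hu fun D N => hb D n N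
  set T : ℕ → ℂ⟦X⟧⟦X⟧ := fun n => ∑' N, recip N * shiftedProd y z ι n N with hT
  have hstep : ∀ n, T n - T (n + 1) = ζ n * ι n := by
    intro n
    have h1 := ((hs n).hasSum.sub (hs (n + 1)).hasSum).tendsto_sum_nat
    simp only [shiftedProd_telescope hι hζ recip_mul, ← mul_sum, sum_range_sub'] at h1
    have h2 : Tendsto (shiftedProd y z ι n) atTop (𝓝 0) := by
      have h := tendsto_majorant_div.const_mul 2
      rw [mul_zero] at h
      refine tendsto_zero_of_biSeminorm_le hr h fun D N => ?_
      refine (biSeminorm_shiftedProd_le hr (hy D) (hz D) hι n N).trans ?_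
      have h1 : (N : ℝ) + 1 ≤ (N : ℝ) + n + 1 := by
        linarith [(Nat.cast_nonneg n : (0 : ℝ) ≤ n)]
      have hm := one_le_majorant N
      rw [mul_div_assoc', div_mul_eq_mul_div]
      gcongr
    have h3 := (h2.const_sub (shiftedProd y z ι n 0)).const_mul (ζ n)
    rw [tendsto_nhds_unique h1 h3]
    simp [shiftedProd]
  have hT0 : Tendsto T atTop (𝓝 0) := by
    have h := tendsto_tsum_of_biSeminorm_le hr hu (f := fun n N => recip N * shiftedProd y z ι n N)
      (g := fun _ => 0) hb (fun N => ?_) summable_zero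
    · simpa using h
    · have h1 : Tendsto (fun n : ℕ => 2 * majorant N * (1 / ((n : ℝ) + 1))) atTop (𝓝 0) := by
        simpa using tendsto_one_div_add_atTop_nhds_zero_nat.const_mul (2 * majorant N)
      refine tendsto_zero_of_biSeminorm_le hr h1 fun D n => ?_
      have hm := one_le_majorant N
      have hN : (0 : ℝ) ≤ N := Nat.cast_nonneg N
      have h2 : 1 / ((N : ℝ) + 1) ≤ 1 := by
        rw [div_le_one (by linarith)]
        linarith
      calc biSeminorm hr D (recip N * shiftedProd y z ι n N)
          ≤ 1 * (2 / ((N : ℝ) + n + 1) * majorant N) :=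
            (map_mul_le_mul _ _ _).trans (mul_le_mul ((biSeminorm_recip_le hr D N).trans h2)
              (biSeminorm_shiftedProd_le hr (hy D) (hz D) hι n N) (apply_nonneg _ _) (by positivity))
        _ ≤ 1 * (2 / ((n : ℝ) + 1) * majorant N) := by
            gcongr
            linarith
        _ = _ := by ring
  have hsζ : Summable fun n => ζ n * ι n := by
    refine summable_of_biSeminorm_le hr (summable_majorant.mul_left 4) fun D n => ?_
    have hz2 : biSeminorm hr D z ≤ 1 / 2 := (hz D).trans (by norm_num)
    calc biSeminorm hr D (ζ n * ι n) ≤ 2 / ((n : ℝ) + 1) * (2 / ((n : ℝ) + 1)) :=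
          (map_mul_le_mul _ _ _).trans (mul_le_mul (biSeminorm_inverse_le hr hz2 (hζ n))
            (biSeminorm_inverse_le hr (hy D) (hι n)) (apply_nonneg _ _) (by positivity))
      _ = 4 * (1 ^ 2 / ((n : ℝ) + 1) ^ 2) := by field_simp; norm_num
      _ ≤ _ := by
          have := one_le_majorant n
          gcongr
  have h1 := hsζ.hasSum.tendsto_sum_nat
  simp only [← hstep, sum_range_sub'] at h1
  have h2 := hT0.const_sub (T 0)
  rw [sub_zero] at h2
  have h3 : ∑' n, ζ n * ι n = T 0 := by
    simp only [← hstep]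
    exact tendsto_nhds_unique h1 h2
  rw [h3]
  exact (hs 0).hasSum

end SumFormula

section MainSeries
variable {r : ℝ} (hr : 0 < r)

lemma shiftedProd_zero {R : Type*} [CommRing R] {y z : R} {ι : ℕ → R}
    (hι : ∀ n, ι n * ((n : R) + 1 - y) = 1) (N : ℕ) :
    shiftedProd y z ι 0 N = ι N * risingProd z ι N := by
  rw [shiftedProd, risingProd]
  congr 1
  refine prod_congr rfl fun j _ => ?_
  rw [add_zero]
  linear_combination hι j

lemma hasSum_sub_recip_mul_risingProd {y z : ℂ⟦X⟧⟦X⟧} {ι ζ : ℕ → ℂ⟦X⟧⟦X⟧}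
    (hy : ∀ D, biSeminorm hr D y ≤ 1 / 2) (hz : ∀ D, biSeminorm hr D z ≤ 1 / 16)
    (hι : ∀ n, ι n * ((n : ℂ⟦X⟧⟦X⟧) + 1 - y) = 1) (hζ : ∀ n, ζ n * ((n : ℂ⟦X⟧⟦X⟧) + 1 - z) = 1) :
    HasSum (fun N => (ι N - recip N) * risingProd z ι N) (y * ∑' n, ζ n * ι n) := by
  refine ((hasSum_recip_mul_shiftedProd hr hy hz hι hζ).mul_left y).congr_fun fun N => ?_
  rw [shiftedProd_zero hι]
  linear_combination recip N * risingProd z ι N * hι N - ι N * risingProd z ι N * recip_mul N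

lemma hasSum_difference {x y z : ℂ⟦X⟧⟦X⟧} {ι κ μ ζ ξ : ℕ → ℂ⟦X⟧⟦X⟧}
    (hx : ∀ D, biSeminorm hr D x ≤ 1 / 2) (hy : ∀ D, biSeminorm hr D y ≤ 1 / 2)
    (hz : ∀ D, biSeminorm hr D z ≤ 1 / 16)
    (hι : ∀ n, ι n * ((n : ℂ⟦X⟧⟦X⟧) + 1 - x) = 1) (hκ : ∀ n, κ n * ((n : ℂ⟦X⟧⟦X⟧) + 1 - y) = 1)
    (hμ : ∀ n, μ n * ((n : ℂ⟦X⟧⟦X⟧) + 1 - (x + y)) = 1)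
    (hζ : ∀ n, ζ n * ((n : ℂ⟦X⟧⟦X⟧) + 1 - z) = 1) (hξ : ∀ n, ξ n * ((n : ℂ⟦X⟧⟦X⟧) + 1 - -z) = 1) :
    HasSum (fun N => z * ((μ N - recip N) * risingProd z κ N
        - (μ N - recip N) * risingProd (-z) ι N))
      (1 - (∑' k, ratioCoeff (-z) ι k) * (∑' k, ratioCoeff z κ k)
        + z * (y * ∑' n, ζ n * κ n) - z * (x * ∑' n, ξ n * ι n)) := by
  have hz' : ∀ D, biSeminorm hr D (-z) ≤ 1 / 16 := fun D => (map_neg_eq_map _ z).trans_le (hz D)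
  have h1 := hasSum_coeff_risingSeries_mul hr hz' hx hy hι hκ
  have h2 := hasSum_sub_recip_mul_risingProd hr hx hz' hι hξ
  have h3 := hasSum_sub_recip_mul_risingProd hr hy hz hκ hζ
  rw [neg_neg] at h1
  have h4 := (hasSum_nat_add_iff' 1).2 h1
  rw [sum_range_one] at h4
  have h5 : coeff 0 (risingSeries (-z) ι * risingSeries z κ) = 1 := by
    simp [risingSeries, risingCoeff]
  rw [h5] at h4
  have h6 := (h4.neg.add (h3.mul_left z)).sub (h2.mul_left z)
  rw [neg_sub] at h6
  refine h6.congr_fun fun N => ?_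
  have h7 := coeff_risingSeries_mul (w := -z) hι hκ (N + 1)
  rw [neg_neg, risingCoeff, risingCoeff] at h7
  push_cast at h7
  linear_combination μ N * h7
    - coeff (N + 1) (risingSeries (-z) ι * risingSeries z κ) * hμ N
    + (z * κ N * risingProd z κ N - z * ι N * risingProd (-z) ι N) * hμ N
    - z * μ N * risingProd z κ N * hκ N + z * μ N * risingProd (-z) ι N * hι N

end MainSeries

section Newton
variable {A : Type*} [CommRing A]

/-- The coefficients of `f` up to degree four are those of `exp (∑ p_k X ^ k / k)`. -/
def HasPowerSums (f : A⟦X⟧) (p : ℕ → A) : Prop :=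
  coeff 0 f = 1 ∧ coeff 1 f = p 1 ∧ 2 * coeff 2 f = p 1 ^ 2 + p 2 ∧
    6 * coeff 3 f = p 1 ^ 3 + 3 * p 1 * p 2 + 2 * p 3 ∧
    24 * coeff 4 f = p 1 ^ 4 + 6 * p 1 ^ 2 * p 2 + 3 * p 2 ^ 2 + 8 * p 1 * p 3 + 6 * p 4

lemma HasPowerSums.one : HasPowerSums (1 : A⟦X⟧) 0 := by
  simp [HasPowerSums, coeff_one]

lemma HasPowerSums.mul {f g : A⟦X⟧} {p q : ℕ → A} (hf : HasPowerSums f p)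
    (hg : HasPowerSums g q) : HasPowerSums (f * g) (p + q) := by
  obtain ⟨f0, f1, f2, f3, f4⟩ := hf
  obtain ⟨g0, g1, g2, g3, g4⟩ := hg
  refine ⟨?_, ?_, ?_, ?_, ?_⟩ <;>
    simp only [coeff_mul, Finset.Nat.antidiagonal_succ, Finset.Nat.antidiagonal_zero, sum_cons,
      map_singleton, sum_singleton, map_cons, Function.Embedding.prodMap,
      Function.Embedding.coeFn_mk, Prod.map, Nat.succ_eq_add_one, zero_add, Pi.add_apply,
      Function.Embedding.refl_apply, Nat.reduceAdd, f0, g0, f1, g1]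
  · simp
  · ring
  · linear_combination f2 + g2
  · linear_combination f3 + g3 + 3 * q 1 * f2 + 3 * p 1 * g2
  · linear_combination f4 + g4 + 4 * q 1 * f3 + 4 * p 1 * g3 + 12 * coeff 2 g * f2
      + 6 * (p 1 ^ 2 + p 2) * g2

lemma HasPowerSums.prod {α : Type*} (s : Finset α) {f : α → A⟦X⟧} {p : α → ℕ → A}
    (h : ∀ i, HasPowerSums (f i) (p i)) : HasPowerSums (∏ i ∈ s, f i) (∑ i ∈ s, p i) := by
  classical
  induction s using Finset.induction_on with
  | empty => simpa using HasPowerSums.one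
  | insert a s ha ih =>
    rw [prod_insert ha, sum_insert ha]
    exact (h a).mul ih

lemma HasPowerSums.linear (α : A) :
    HasPowerSums (1 + X * C α) (fun k => -(-α) ^ k) := by
  refine ⟨?_, ?_, ?_, ?_, ?_⟩ <;> simp [coeff_one, coeff_X] <;> ring

lemma HasPowerSums.geometric (β : A) :
    HasPowerSums (PowerSeries.mk fun a => β ^ a) (fun k => β ^ k) := by
  refine ⟨?_, ?_, ?_, ?_, ?_⟩ <;> simp only [coeff_mk] <;> ring

end Newton

section NestedSum
variable {R : Type*} [CommRing R]

/-- The nested sum `∑_{N > j₁ > ⋯ > j_a ≥ 0} f j₁ ⋯ f j_a`. -/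
def nestedSum (f : ℕ → R) : ℕ → ℕ → R
  | 0, _ => 1
  | a + 1, N => ∑ j ∈ range N, f j * nestedSum f a j

lemma coeff_risingProd (u : R) (f : ℕ → R) (a N : ℕ) :
    coeff a (risingProd (C u * X) (fun n => C (f n)) N) = u ^ a * nestedSum f a N := by
  induction N generalizing a with
  | zero => cases a <;> simp [risingProd_zero, nestedSum, coeff_one]
  | succ N ih =>
    have h : risingProd (C u * X) (fun n => C (f n)) (N + 1)
        = risingProd (C u * X) (fun n => C (f n)) N
          + C (u * f N) * (X * risingProd (C u * X) (fun n => C (f n)) N) := by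
      rw [risingProd_succ, map_mul]
      ring
    rw [h, map_add, coeff_C_mul, ih]
    cases a with
    | zero => simp [nestedSum]
    | succ a =>
      rw [coeff_succ_X_mul, ih, nestedSum, nestedSum, sum_range_succ]
      ring

lemma nestedSum_le {f : ℕ → ℝ} (hf : ∀ n, 0 ≤ f n) {u : ℝ} (hu : 0 ≤ u) (a N : ℕ) :
    u ^ a * nestedSum f a N ≤ ∏ j ∈ range N, (1 + u * f j) := by
  induction N generalizing a with
  | zero => cases a <;> simp [nestedSum]
  | succ N ih =>
    rw [prod_range_succ]
    cases a with
    | zero =>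
      refine (ih 0).trans (le_mul_of_one_le_right (prod_nonneg fun j _ => ?_) ?_)
      · exact add_nonneg zero_le_one (mul_nonneg hu (hf j))
      · exact le_add_of_nonneg_right (mul_nonneg hu (hf N))
    | succ a =>
      have h1 := ih (a + 1)
      have h2 := mul_le_mul_of_nonneg_left (ih a) (mul_nonneg hu (hf N))
      rw [nestedSum] at h1
      rw [nestedSum, sum_range_succ]
      linear_combination h1 + h2

end NestedSum

section LinearInverse

/-- The inverse of `n + 1 - c X`. -/
noncomputable def linInv (c : ℂ) (n : ℕ) : ℂ⟦X⟧ :=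
  PowerSeries.mk fun d => c ^ d / ((n : ℂ) + 1) ^ (d + 1)

lemma linInv_mul (c : ℂ) (n : ℕ) : linInv c n * ((n : ℂ⟦X⟧) + 1 - C c * X) = 1 := by
  have h0 : (n : ℂ) + 1 ≠ 0 := Nat.cast_add_one_ne_zero n
  have h : linInv c n * ((n : ℂ⟦X⟧) + 1 - C c * X)
      = C ((n : ℂ) + 1) * linInv c n - C c * (X * linInv c n) := by
    rw [map_add, map_natCast, map_one]
    ring
  rw [h]
  ext d
  rw [map_sub, coeff_C_mul, coeff_C_mul]
  cases d with
  | zero => simp [linInv, h0]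
  | succ d =>
    rw [coeff_succ_X_mul, coeff_one, if_neg d.succ_ne_zero]
    simp only [linInv, coeff_mk]
    field_simp
    ring

lemma coeff_linInv_pow (c : ℂ) (n k d : ℕ) :
    coeff d (linInv c n ^ (k + 1))
      = ((k + d).choose k : ℂ) * c ^ d * (((n : ℂ) + 1) ^ (d + k + 1))⁻¹ := by
  have h : linInv c n = C (1 / ((n : ℂ) + 1)) * rescale (c / ((n : ℂ) + 1)) (PowerSeries.mk 1) := by
    ext d
    simp only [linInv, coeff_mk, coeff_C_mul, coeff_rescale, Pi.one_apply]
    rw [div_pow, pow_succ]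
    field_simp
  rw [h, mul_pow, ← map_pow, ← map_pow, coeff_C_mul, mk_one_pow_eq_mk_choose_add, coeff_rescale,
    coeff_mk, div_pow, div_pow, one_pow]
  field_simp
  ring

lemma coeff_prod_fin {R : Type*} [CommRing R] {k : ℕ} (f : Fin k → R⟦X⟧) (n : ℕ) :
    coeff n (∏ i, f i) = ∑ c ∈ Finset.Nat.antidiagonalTuple k n, ∏ i, coeff (c i) (f i) := by
  classical
  rw [coeff_prod]
  refine sum_nbij' (fun c => c) (fun c => Finsupp.equivFunOnFinite.symm c) ?_ ?_ ?_ ?_ ?_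
  · intro c hc
    rw [mem_finsuppAntidiag] at hc
    exact Finset.Nat.mem_antidiagonalTuple.2 hc.1
  · intro c hc
    rw [mem_finsuppAntidiag]
    exact ⟨Finset.Nat.mem_antidiagonalTuple.1 hc, subset_univ _⟩
  · intro c _
    ext i
    rfl
  · intro c _
    rfl
  · intro c _
    rfl

lemma coeff_linInv_tuple (x y : ℂ) (d : ℕ) (m : Fin 4 → ℕ) :
    coeff d ((linInv x (m 0) - C (1 / ((m 0 : ℂ) + 1)))
        * (linInv y (m 1) * (linInv y (m 2) * linInv y (m 3))))
      = ∑ c ∈ (Finset.Nat.antidiagonalTuple 4 (d + 4)).filter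
          (fun c => 2 ≤ c 0 ∧ ∀ i, 1 ≤ c i),
        x ^ (c 0 - 1) * y ^ (d + 4 - c 0 - 3) * ∏ i, (((m i : ℂ) + 1) ^ (c i))⁻¹ := by
  set g : ℂ⟦X⟧ := linInv x (m 0) - C (1 / ((m 0 : ℂ) + 1)) with hg
  have h1 : coeff d (g * (linInv y (m 1) * (linInv y (m 2) * linInv y (m 3))))
      = coeff (d + 4) (∏ i, (![X * g, X * linInv y (m 1), X * linInv y (m 2),
          X * linInv y (m 3)] : Fin 4 → ℂ⟦X⟧) i) := by
    have h : ∏ i, (![X * g, X * linInv y (m 1), X * linInv y (m 2),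
        X * linInv y (m 3)] : Fin 4 → ℂ⟦X⟧) i
        = X ^ 4 * (g * (linInv y (m 1) * (linInv y (m 2) * linInv y (m 3)))) := by
      rw [Fin.prod_univ_four]
      simp only [Matrix.cons_val]
      ring
    rw [h, coeff_X_pow_mul]
  have h2 : ∀ (n c : ℕ), coeff c (X * linInv y n)
      = if 1 ≤ c then y ^ (c - 1) * (((n : ℂ) + 1) ^ c)⁻¹ else 0 := by
    intro n c
    cases c with
    | zero => simp
    | succ c => simp [coeff_succ_X_mul, linInv, div_eq_mul_inv]
  have h3 : ∀ c : ℕ, coeff c (X * g)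
      = if 2 ≤ c then x ^ (c - 1) * (((m 0 : ℂ) + 1) ^ c)⁻¹ else 0 := by
    intro c
    rcases c with _ | _ | c
    · simp
    · simp [hg, coeff_succ_X_mul, linInv]
    · rw [coeff_succ_X_mul, hg, map_sub, coeff_C, if_neg c.succ_ne_zero]
      simp [linInv, div_eq_mul_inv]
  rw [h1, coeff_prod_fin, sum_filter]
  refine sum_congr rfl fun c hc => ?_
  rw [Finset.Nat.mem_antidiagonalTuple, Fin.sum_univ_four] at hc
  simp only [Fin.prod_univ_four, Matrix.cons_val, h2, h3]
  by_cases hcond : 2 ≤ c 0 ∧ ∀ i, 1 ≤ c i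
  · rw [if_pos hcond, if_pos hcond.1, if_pos (hcond.2 1), if_pos (hcond.2 2), if_pos (hcond.2 3)]
    have h4 : d + 4 - c 0 - 3 = (c 1 - 1) + (c 2 - 1) + (c 3 - 1) := by
      have := hcond.2 1
      have := hcond.2 2
      have := hcond.2 3
      omega
    rw [h4, pow_add, pow_add]
    ring
  · rw [if_neg hcond]
    by_contra hne
    simp only [mul_eq_zero, not_or, ite_eq_right_iff, Classical.not_imp] at hne
    obtain ⟨⟨⟨⟨h0, _⟩, h1, _⟩, h2, _⟩, h3, _⟩ := hne
    refine hcond ⟨h0, fun i => ?_⟩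
    fin_cases i
    · exact one_le_two.trans h0
    · exact h1
    · exact h2
    · exact h3

end LinearInverse

section DepthFour

/-- Quadruples `N > j > k > i ≥ 0` of natural numbers. -/
abbrev DecreasingQuadruple : Type := Σ N : ℕ, Σ j : Fin N, Σ k : Fin j, Fin k

/-- The entries of a quadruple. -/
def DecreasingQuadruple.entries (t : DecreasingQuadruple) : Fin 4 → ℕ :=
  ![t.1, t.2.1, t.2.2.1, t.2.2.2]

/-- Shifting the entries by one gives the summation range of a multiple zeta value. -/
def DecreasingQuadruple.equiv :
    DecreasingQuadruple ≃ {m : Fin 4 → ℕ // StrictAnti m ∧ ∀ i, 0 < m i} where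
  toFun t := ⟨fun i => t.entries i + 1, by
    refine ⟨Fin.strictAnti_iff_succ_lt.2 fun i => ?_, fun i => Nat.succ_pos _⟩
    obtain ⟨N, j, k, i'⟩ := t
    have := j.2
    have := k.2
    have := i'.2
    fin_cases i <;> simp [entries]⟩
  invFun m :=
    have h1 : m.1 1 < m.1 0 := m.2.1 (by decide)
    have h2 : m.1 2 < m.1 1 := m.2.1 (by decide)
    have h3 : m.1 3 < m.1 2 := m.2.1 (by decide)
    have h4 := m.2.2 3
    ⟨m.1 0 - 1, ⟨m.1 1 - 1, by omega⟩, ⟨m.1 2 - 1, by simp only; omega⟩,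
      ⟨m.1 3 - 1, by simp only; omega⟩⟩
  left_inv t := rfl
  right_inv m := by
    have h := m.2.2
    ext i
    have := h i
    fin_cases i <;> simp [entries] <;> simp at this <;> omega

lemma sum_quadruple {M : Type*} [AddCommMonoid M] (N : ℕ) (F : ℕ → ℕ → ℕ → M) :
    ∑ t : (Σ j : Fin N, Σ k : Fin j, Fin k), F t.1 t.2.1 t.2.2
      = ∑ j ∈ range N, ∑ k ∈ range j, ∑ i ∈ range k, F j k i := by
  rw [Fintype.sum_sigma, ← Fin.sum_univ_eq_sum_range (fun j => ∑ k ∈ range j, ∑ i ∈ range k, F j k i)]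
  refine sum_congr rfl fun j _ => ?_
  rw [Fintype.sum_sigma, ← Fin.sum_univ_eq_sum_range (fun k => ∑ i ∈ range k, F j k i)]
  refine sum_congr rfl fun k _ => ?_
  rw [← Fin.sum_univ_eq_sum_range (fun i => F j k i)]

lemma nestedSum_three {R : Type*} [CommRing R] (f : ℕ → R) (N : ℕ) :
    nestedSum f 3 N = ∑ j ∈ range N, ∑ k ∈ range j, ∑ i ∈ range k, f j * (f k * f i) := by
  simp only [nestedSum, mul_sum, mul_one]

lemma summable_quadruple_bound :
    Summable fun t : DecreasingQuadruple => 1 / ((t.1 : ℝ) + 1) ^ 2 * (1 / ((t.2.1 : ℝ) + 1)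
      * (1 / ((t.2.2.1 : ℝ) + 1) * (1 / ((t.2.2.2 : ℝ) + 1)))) := by
  rw [summable_sigma_of_nonneg fun t => by positivity]
  refine ⟨fun N => (hasSum_fintype _).summable, ?_⟩
  have h : ∀ N : ℕ, ∑' t : (Σ j : Fin N, Σ k : Fin j, Fin k), 1 / ((N : ℝ) + 1) ^ 2
      * (1 / ((t.1 : ℝ) + 1) * (1 / ((t.2.1 : ℝ) + 1) * (1 / ((t.2.2 : ℝ) + 1))))
      = 1 / ((N : ℝ) + 1) ^ 2 * nestedSum (fun j => 1 / ((j : ℝ) + 1)) 3 N := by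
    intro N
    rw [tsum_fintype, ← mul_sum, nestedSum_three, ← sum_quadruple N]
  simp only [h]
  refine Summable.of_nonneg_of_le (fun N => ?_) (fun N => ?_) (summable_majorant.mul_left (8 ^ 3))
  · rw [nestedSum_three]
    positivity
  · have h1 := nestedSum_le (f := fun j : ℕ => 1 / ((j : ℝ) + 1)) (fun n => by positivity)
      (show (0 : ℝ) ≤ 1 / 8 by norm_num) 3 N
    have h2 : ∏ j ∈ range N, (1 + 1 / 8 * (1 / ((j : ℝ) + 1))) = majorant N := by
      refine prod_congr rfl fun j _ => ?_
      field_simp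
    rw [h2] at h1
    have h3 := h1.trans (majorant_le_sq N)
    rw [one_div_mul_eq_div, ← mul_div_assoc]
    gcongr
    linarith

lemma hasSum_mzv {c : Fin 4 → ℕ} (h0 : 2 ≤ c 0) (h : ∀ i, 1 ≤ c i) :
    HasSum (fun t : DecreasingQuadruple => ∏ i, (((t.entries i : ℂ) + 1) ^ (c i))⁻¹)
      (mzv c : ℂ) := by
  have h1 : Summable fun t : DecreasingQuadruple => ∏ i, (((t.entries i : ℝ) + 1) ^ (c i))⁻¹ := by
    refine Summable.of_nonneg_of_le (fun t => by positivity) (fun t => ?_) summable_quadruple_bound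
    have h2 : ∀ n k c : ℕ, k ≤ c → (((n : ℝ) + 1) ^ c)⁻¹ ≤ (((n : ℝ) + 1) ^ k)⁻¹ := by
      intro n k c hk
      gcongr
      linarith [(Nat.cast_nonneg n : (0 : ℝ) ≤ n)]
    rw [Fin.prod_univ_four, mul_assoc, mul_assoc]
    simp only [one_div]
    refine mul_le_mul (h2 _ _ _ h0) (mul_le_mul ?_ (mul_le_mul ?_ ?_ ?_ ?_) ?_ ?_) ?_ ?_
    · exact (h2 _ 1 _ (h 1)).trans_eq (by rw [pow_one]; rfl)
    · exact (h2 _ 1 _ (h 2)).trans_eq (by rw [pow_one]; rfl)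
    · exact (h2 _ 1 _ (h 3)).trans_eq (by rw [pow_one]; rfl)
    all_goals positivity
  have h2 : HasSum (fun t : DecreasingQuadruple => ∏ i, (((t.entries i : ℝ) + 1) ^ (c i))⁻¹)
      (mzv c) := by
    have h3 : mzv c = ∑' t : DecreasingQuadruple, ∏ i, (((t.entries i : ℝ) + 1) ^ (c i))⁻¹ := by
      rw [mzv, ← DecreasingQuadruple.equiv.tsum_eq]
      refine tsum_congr fun t => prod_congr rfl fun i _ => ?_
      rw [← Nat.cast_add_one]
      rfl
    rw [h3]
    exact h1.hasSum
  simpa using Complex.hasSum_ofReal.2 h2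

lemma hasSum_G (d : ℕ) (x y : ℂ) :
    HasSum (fun N => coeff d ((linInv x N - C (1 / ((N : ℂ) + 1))) * nestedSum (linInv y) 3 N))
      (G (d + 4) 4 x y) := by
  have h1 : HasSum (fun t : DecreasingQuadruple =>
      coeff d ((linInv x (t.entries 0) - C (1 / ((t.entries 0 : ℂ) + 1)))
        * (linInv y (t.entries 1) * (linInv y (t.entries 2) * linInv y (t.entries 3)))))
      (G (d + 4) 4 x y) := by
    simp only [coeff_linInv_tuple]
    refine hasSum_sum fun c hc => ?_
    rw [mem_filter] at hc
    exact (hasSum_mzv hc.2.1 hc.2.2).mul_left _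
  refine h1.sigma fun N => ?_
  rw [nestedSum_three, mul_sum, map_sum]
  simp only [mul_sum, map_sum]
  rw [← sum_quadruple N fun j k i => coeff d ((linInv x N - C (1 / ((N : ℂ) + 1)))
    * (linInv y j * (linInv y k * linInv y i)))]
  exact hasSum_fintype _

end DepthFour

section Extraction

lemma hasSum_rz {k : ℕ} (hk : 2 ≤ k) :
    HasSum (fun n : ℕ => (((n : ℂ) + 1) ^ k)⁻¹) (rz k : ℂ) := by
  have h1 : Summable fun n : ℕ => (((n : ℝ) + 1) ^ k)⁻¹ := by
    simpa using (summable_nat_add_iff 1).2 (Real.summable_nat_pow_inv.2 hk)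
  have h2 : rz k = ∑' n : ℕ, (((n : ℝ) + 1) ^ k)⁻¹ := by
    rw [rz, tsum_pnat_eq_tsum_succ (f := fun n : ℕ => (((n : ℝ)) ^ k)⁻¹)]
    simp
  rw [h2]
  simpa using Complex.hasSum_ofReal.2 h1.hasSum

lemma C_linInv_mul (c : ℂ) (n : ℕ) :
    C (linInv c n) * ((n : ℂ⟦X⟧⟦X⟧) + 1 - C (C c * X)) = 1 := by
  simpa using congrArg (C (R := ℂ⟦X⟧)) (linInv_mul c n)

lemma map_linInv_mul (c : ℂ) (n : ℕ) :
    PowerSeries.map C (linInv c n) * ((n : ℂ⟦X⟧⟦X⟧) + 1 - C (C c) * X) = 1 := by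
  simpa using congrArg (PowerSeries.map (C (R := ℂ))) (linInv_mul c n)

lemma hasSum_linInv_mul (u c : ℂ) :
    HasSum (fun n => PowerSeries.map C (linInv u n) * C (linInv c n))
      (PowerSeries.mk fun a => PowerSeries.mk fun d => u ^ a * c ^ d * (rz (a + d + 2) : ℂ)) := by
  rw [WithPiTopology.hasSum_iff_hasSum_coeff]
  intro a
  rw [WithPiTopology.hasSum_iff_hasSum_coeff]
  intro d
  simp only [coeff_mk, coeff_mul_C, coeff_map, coeff_C_mul, linInv]
  refine ((hasSum_rz (k := a + d + 2) (by omega)).mul_left (u ^ a * c ^ d)).congr_fun fun n => ?_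
  have h0 : (n : ℂ) + 1 ≠ 0 := Nat.cast_add_one_ne_zero n
  field_simp
  ring

lemma mk_pow_mul {A : Type*} [CommRing A] (b : A) :
    (PowerSeries.mk fun a => b ^ a) * (1 - X * C b) = 1 := by
  have h : (PowerSeries.mk fun a => b ^ a) * (1 - X * C b)
      = (PowerSeries.mk fun a => b ^ a) - X * (C b * PowerSeries.mk fun a => b ^ a) := by ring
  rw [h]
  ext n
  cases n with
  | zero => simp
  | succ n => simp [coeff_succ_X_mul, coeff_one, pow_succ']

/-- The limit of the `k`-th power sums of the zeros of the product. -/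
noncomputable def limitPowerSum (x y : ℂ) (k : ℕ) : ℂ⟦X⟧ :=
  PowerSeries.mk fun d => if d = 0 then 0 else
    -(((k - 1 + d).choose (k - 1) : ℂ) * (x ^ d + (-1) ^ k * y ^ d)) * (rz (d + k) : ℂ)

/-- The `k`-th power sum attached to the `i`-th factors of the product. -/
noncomputable def factorPowerSum (x y : ℂ) (i k : ℕ) : ℂ⟦X⟧ :=
  -linInv x i ^ k - (-linInv y i) ^ k + C (1 / ((i : ℂ) + 1)) ^ k + (-C (1 / ((i : ℂ) + 1))) ^ k

lemma hasSum_factorPowerSum (x y : ℂ) {k : ℕ} (hk : 1 ≤ k) :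
    HasSum (fun i => factorPowerSum x y i k) (limitPowerSum x y k) := by
  obtain ⟨k, rfl⟩ := Nat.exists_eq_add_of_le' hk
  rw [WithPiTopology.hasSum_iff_hasSum_coeff]
  intro d
  have h : ∀ i, coeff d (factorPowerSum x y i (k + 1)) = if d = 0 then 0 else
      -(((k + d).choose k : ℂ) * (x ^ d + (-1) ^ (k + 1) * y ^ d))
        * (((i : ℂ) + 1) ^ (d + (k + 1)))⁻¹ := by
    intro i
    have h1 : factorPowerSum x y i (k + 1) = -linInv x i ^ (k + 1)
        - C ((-1) ^ (k + 1)) * linInv y i ^ (k + 1)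
        + C ((1 / ((i : ℂ) + 1)) ^ (k + 1) * (1 + (-1) ^ (k + 1))) := by
      rw [factorPowerSum, neg_pow (linInv y i), neg_pow (C _)]
      simp only [map_mul, map_add, map_pow, map_neg, map_one]
      ring
    rw [h1, map_add, map_sub, map_neg, coeff_C_mul, coeff_linInv_pow, coeff_linInv_pow, coeff_C]
    split_ifs with hd
    · subst hd
      simp
      ring
    · ring
  simp only [h, limitPowerSum, coeff_mk, Nat.add_sub_cancel]
  split_ifs with hd
  · exact hasSum_zero
  · exact (hasSum_rz (by omega)).mul_left _

lemma hasPowerSums_product (x y : ℂ) (n : ℕ) :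
    HasPowerSums (risingProd (-X) (fun i => C (linInv x i)) n
        * (∏ i ∈ range n, PowerSeries.mk fun a => C (1 / ((i : ℂ) + 1)) ^ a)
        * (risingProd X (fun i => C (linInv y i)) n
          * ∏ i ∈ range n, PowerSeries.mk fun a => (-C (1 / ((i : ℂ) + 1))) ^ a))
      (∑ i ∈ range n, factorPowerSum x y i) := by
  have h1 : ∀ i, HasPowerSums (1 + -X * C (linInv x i)) (fun k => -linInv x i ^ k) := fun i => by
    simpa using HasPowerSums.linear (-linInv x i)
  have h2 := ((HasPowerSums.prod (range n) h1).mul (.prod (range n) fun i =>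
    .geometric (C (1 / ((i : ℂ) + 1))))).mul ((HasPowerSums.prod (range n) fun i =>
      .linear (linInv y i)).mul (.prod (range n) fun i => .geometric (-C (1 / ((i : ℂ) + 1)))))
  rw [← sum_add_distrib, ← sum_add_distrib, ← sum_add_distrib] at h2
  have h3 : ∀ i, factorPowerSum x y i = ((fun k => -linInv x i ^ k)
      + fun k => C (1 / ((i : ℂ) + 1)) ^ k) + ((fun k => -(-linInv y i) ^ k)
      + fun k => (-C (1 / ((i : ℂ) + 1))) ^ k) := fun i => by
    ext1 k
    simp only [factorPowerSum, Pi.add_apply]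
    ring
  simp only [h3]
  exact h2

lemma hasPowerSums_limit {r : ℝ} (hr : 0 < r) {x y : ℂ}
    (hx : ∀ D, biSeminorm hr D (C (C x * X)) ≤ 1 / 2)
    (hy : ∀ D, biSeminorm hr D (C (C y * X)) ≤ 1 / 2) :
    HasPowerSums ((∑' k, ratioCoeff (-X) (fun i => C (linInv x i)) k)
      * ∑' k, ratioCoeff X (fun i => C (linInv y i)) k) (limitPowerSum x y) := by
  have hX : ∀ D, biSeminorm hr D (-X) ≤ 1 / 16 := fun D =>
    (map_neg_eq_map _ _).trans_le (biSeminorm_X_le hr D)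
  have h1 := tendsto_risingProd_mul_prod hr hX hx (C_linInv_mul x)
    (e := fun i => PowerSeries.mk fun a => C (1 / ((i : ℂ) + 1)) ^ a) fun n =>
      Eq.trans (by rw [recip]; ring) (mk_pow_mul (C (1 / ((n : ℂ) + 1))))
  have h2 := tendsto_risingProd_mul_prod hr (biSeminorm_X_le hr) hy (C_linInv_mul y)
    (e := fun i => PowerSeries.mk fun a => (-C (1 / ((i : ℂ) + 1))) ^ a) fun n =>
      Eq.trans (by rw [recip, map_neg]; ring) (mk_pow_mul (-C (1 / ((n : ℂ) + 1))))
  have h3 := h1.mul h2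
  have hc : ∀ a, Tendsto _ atTop (𝓝 _) := fun a =>
    (WithPiTopology.tendsto_iff_coeff_tendsto _ _ _ _).1 h3 a
  have hp : ∀ k, 1 ≤ k → Tendsto (fun n => (∑ i ∈ range n, factorPowerSum x y i) k) atTop
      (𝓝 (limitPowerSum x y k)) := fun k hk => by
    simpa only [Finset.sum_apply] using (hasSum_factorPowerSum x y hk).tendsto_sum_nat
  have p1 := hp 1 le_rfl
  have p2 := hp 2 (by norm_num)
  have p3 := hp 3 (by norm_num)
  have p4 := hp 4 (by norm_num)
  have hn := hasPowerSums_product x y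
  refine ⟨?_, ?_, ?_, ?_, ?_⟩
  · exact tendsto_nhds_unique (hc 0) (tendsto_const_nhds.congr fun n => (hn n).1.symm)
  · exact tendsto_nhds_unique (hc 1) (p1.congr fun n => (hn n).2.1.symm)
  · exact tendsto_nhds_unique ((hc 2).const_mul 2)
      (((p1.pow 2).add p2).congr fun n => (hn n).2.2.1.symm)
  · exact tendsto_nhds_unique ((hc 3).const_mul 6)
      ((((p1.pow 3).add ((p1.const_mul 3).mul p2)).add (p3.const_mul 2)).congr
        fun n => (hn n).2.2.2.1.symm)
  · exact tendsto_nhds_unique ((hc 4).const_mul 24)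
      ((((((p1.pow 4).add (((p1.pow 2).const_mul 6).mul p2)).add ((p2.pow 2).const_mul 3)).add
        ((p1.const_mul 8).mul p3)).add (p4.const_mul 6)).congr fun n => (hn n).2.2.2.2.symm)

lemma exists_radius (x y : ℂ) : ∃ (r : ℝ) (hr : 0 < r),
    ∀ c : ℂ, ‖c‖ ≤ ‖x‖ + ‖y‖ → ∀ D, biSeminorm hr D (C (C c * X)) ≤ 1 / 2 := by
  have h0 : 0 < 2 * (‖x‖ + ‖y‖ + 1) := by positivity
  refine ⟨(2 * (‖x‖ + ‖y‖ + 1))⁻¹, inv_pos.2 h0, fun c hc D => ?_⟩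
  refine (biSeminorm_C_C_mul_X_le _ D c).trans ?_
  rw [← div_eq_mul_inv, div_le_iff₀ h0]
  linarith

lemma exists_hasPowerSums_G (x y : ℂ) : ∃ f : ℂ⟦X⟧⟦X⟧, HasPowerSums f (limitPowerSum x y) ∧
    ∀ d, G (d + 5) 4 (x + y) y + G (d + 5) 4 (y + x) x
      = (x ^ (d + 1) + y ^ (d + 1)) * (rz (d + 5) : ℂ) - coeff (d + 1) (coeff 4 f) := by
  obtain ⟨r, hr, h⟩ := exists_radius x y
  have hx := h x (by simp)
  have hy := h y (by simp)
  refine ⟨_, hasPowerSums_limit hr hx hy, fun d => ?_⟩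
  have h1 := hasSum_difference hr hx hy (biSeminorm_X_le hr) (C_linInv_mul x) (C_linInv_mul y)
    (μ := fun n => C (linInv (x + y) n)) (ζ := fun n => PowerSeries.map C (linInv 1 n))
    (ξ := fun n => PowerSeries.map C (linInv (-1) n))
    (fun n => by simpa [add_mul] using C_linInv_mul (x + y) n)
    (fun n => by simpa using map_linInv_mul 1 n) (fun n => by simpa using map_linInv_mul (-1) n)
  rw [(hasSum_linInv_mul 1 y).tsum_eq, (hasSum_linInv_mul (-1) x).tsum_eq] at h1
  have h2 := hasSum_coeff_coeff h1 4 (d + 1)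
  have h3 := (hasSum_G (d + 1) (x + y) y).add (hasSum_G (d + 1) (y + x) x)
  have h4 : ∀ (u : ℂ⟦X⟧) (f : ℕ → ℂ⟦X⟧) (N : ℕ),
      coeff 3 (risingProd (C u * X) (fun n => C (f n)) N) = u ^ 3 * nestedSum f 3 N :=
    fun u f N => coeff_risingProd u f 3 N
  have h5 := fun f N => h4 1 f N
  have h6 := fun f N => h4 (-1) f N
  simp only [map_one, one_mul, map_neg, neg_mul, one_pow] at h5 h6
  have h7 := h3.unique (h2.congr_fun fun N => ?_)
  · rw [show d + 5 = d + 1 + 4 from rfl, h7]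
    have h8 : ∀ (c : ℂ) (f : ℂ⟦X⟧⟦X⟧), coeff (d + 1) (coeff 4 (X * (C (C c * X) * f)))
        = c * coeff d (coeff 3 f) := by
      intro c f
      rw [show 4 = 3 + 1 from rfl, coeff_succ_X_mul, coeff_C_mul, mul_assoc, coeff_C_mul,
        coeff_succ_X_mul]
    rw [map_sub, map_add, map_sub, map_sub, map_add, map_sub, h8, h8]
    simp only [coeff_mk, coeff_one]
    rw [show d + 1 + 4 = 3 + d + 2 by ring]
    simp
    ring
  · rw [show 4 = 3 + 1 from rfl, coeff_succ_X_mul, recip, ← map_sub, map_sub, coeff_C_mul,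
      coeff_C_mul, h5, h6, add_comm y x]
    simp only [← map_add]
    congr 1
    ring

end Extraction

section Convolution

lemma coeff_mul_eq_sum_Icc {R : Type*} [CommRing R] {f g : R⟦X⟧} (hf : coeff 0 f = 0) {e : ℕ}
    (hg : ∀ k < e, coeff k g = 0) (s n : ℕ) :
    coeff n (f * g) = ∑ j ∈ Icc (s + 1) (n + s - e), coeff (j - s) f * coeff (n + s - j) g := by
  rw [coeff_mul]
  symm
  refine sum_of_injOn (fun j => (j - s, n + s - j)) ?_ ?_ ?_ ?_
  · intro i hi j hj h
    simp only [coe_Icc, Set.mem_Icc, Prod.mk.injEq] at hi hj h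
    omega
  · intro j hj
    simp only [coe_Icc, Set.mem_Icc] at hj
    simp only [mem_coe, HasAntidiagonal.mem_antidiagonal]
    omega
  · rintro ⟨p, q⟩ hpq h
    rw [HasAntidiagonal.mem_antidiagonal] at hpq
    simp only at hpq ⊢
    by_contra hne
    obtain ⟨h1, h2⟩ := ne_zero_and_ne_zero_of_mul hne
    have h3 : p ≠ 0 := fun h => h1 (h ▸ hf)
    have h4 : e ≤ q := not_lt.1 fun h => h2 (hg q h)
    refine h ⟨p + s, ?_, ?_⟩
    · simp only [coe_Icc, Set.mem_Icc]
      omega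
    · simp only [Prod.mk.injEq]
      omega
  · intro j _
    rfl

lemma coeff_mul_eq_zero {R : Type*} [CommRing R] {f g : R⟦X⟧} (hf : coeff 0 f = 0) {e : ℕ}
    (hg : ∀ k < e, coeff k g = 0) {k : ℕ} (hk : k < e + 1) : coeff k (f * g) = 0 := by
  rw [coeff_mul_eq_sum_Icc hf hg 0 k, Icc_eq_empty (by omega), sum_empty]

variable (x y : ℂ)

lemma coeff_zero_limitPowerSum (k : ℕ) : coeff 0 (limitPowerSum x y k) = 0 := by
  simp [limitPowerSum]

lemma coeff_of_lt_one_limitPowerSum (k : ℕ) : ∀ j < 1, coeff j (limitPowerSum x y k) = 0 := by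
  intro j hj
  rw [Nat.lt_one_iff.1 hj, coeff_zero_limitPowerSum]

lemma coeff_limitPowerSum_one (n : ℕ) :
    coeff n (limitPowerSum x y 1) = -((x ^ n - y ^ n) * (rz (n + 1) : ℂ)) := by
  rw [limitPowerSum, coeff_mk]
  split_ifs with h
  · simp [h]
  · simp
    ring

lemma coeff_limitPowerSum_two {n : ℕ} (h : n ≠ 0) :
    coeff n (limitPowerSum x y 2) = -(((n : ℂ) + 1) * (x ^ n + y ^ n) * (rz (n + 2) : ℂ)) := by
  rw [limitPowerSum, coeff_mk, if_neg h, show 2 - 1 = 1 from rfl, Nat.choose_one_right]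
  push_cast
  ring

lemma coeff_limitPowerSum_three (n : ℕ) : coeff n (limitPowerSum x y 3)
    = -(1 / 2 * (((n : ℂ) + 2) * ((n : ℂ) + 1) * (x ^ n - y ^ n) * (rz (n + 3) : ℂ))) := by
  rw [limitPowerSum, coeff_mk]
  split_ifs with h
  · simp [h]
  · rw [Nat.cast_choose_two]
    push_cast
    ring

lemma coeff_limitPowerSum_four {n : ℕ} (h : n ≠ 0) : coeff n (limitPowerSum x y 4)
    = -(1 / 6 * (((n : ℂ) + 3) * ((n : ℂ) + 2) * ((n : ℂ) + 1) * (x ^ n + y ^ n)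
      * (rz (n + 4) : ℂ))) := by
  have h1 : (((n + 2 + 1).choose 3 : ℕ) : ℂ) = (n + 2 + 1) * ((n + 2) * (n + 1) / 2) / 3 := by
    have h2 := congrArg (Nat.cast (R := ℂ)) (Nat.add_one_mul_choose_eq (n + 2) 2)
    rw [Nat.cast_mul, Nat.cast_mul, Nat.cast_choose_two] at h2
    push_cast at h2
    linear_combination -h2 / 3
  rw [limitPowerSum, coeff_mk, if_neg h, show 4 - 1 + n = n + 2 + 1 by omega]
  simp only [Nat.reduceSub, h1]
  ring

lemma coeff_limitPowerSum_one_mul_three (d : ℕ) :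
    coeff (d + 1) (limitPowerSum x y 1 * limitPowerSum x y 3)
      = 1 / 2 * ∑ j ∈ Icc 2 (d + 5 - 4), (((d + 5 : ℕ) : ℂ) - (j : ℂ) - 1)
          * (((d + 5 : ℕ) : ℂ) - (j : ℂ) - 2)
          * (x ^ (j - 1) - y ^ (j - 1)) * (x ^ (d + 5 - j - 3) - y ^ (d + 5 - j - 3))
          * (rz j : ℂ) * (rz (d + 5 - j) : ℂ) := by
  rw [coeff_mul_eq_sum_Icc (coeff_zero_limitPowerSum x y 1) (coeff_of_lt_one_limitPowerSum x y 3) 1,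
    mul_sum]
  refine sum_congr rfl fun j hj => ?_
  rw [mem_Icc] at hj
  obtain ⟨p, rfl⟩ : ∃ p, j = p + 1 := ⟨j - 1, by omega⟩
  obtain ⟨q, hq⟩ : ∃ q, d + 1 = p + q := ⟨d + 1 - p, by omega⟩
  rw [coeff_limitPowerSum_one, coeff_limitPowerSum_three, show d + 1 + 1 - (p + 1) = q by omega,
    show d + 5 - (p + 1) - 3 = q by omega, show d + 5 - (p + 1) = q + 3 by omega,
    show d + 5 = p + q + 4 by omega, Nat.add_sub_cancel]
  push_cast
  ring

lemma coeff_limitPowerSum_two_sq (d : ℕ) :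
    coeff (d + 1) (limitPowerSum x y 2 ^ 2)
      = ∑ j ∈ Icc 3 (d + 5 - 3), ((j : ℂ) - 1) * (((d + 5 : ℕ) : ℂ) - (j : ℂ) - 1)
          * (x ^ (j - 2) + y ^ (j - 2)) * (x ^ (d + 5 - j - 2) + y ^ (d + 5 - j - 2))
          * (rz j : ℂ) * (rz (d + 5 - j) : ℂ) := by
  rw [pow_two,
    coeff_mul_eq_sum_Icc (coeff_zero_limitPowerSum x y 2) (coeff_of_lt_one_limitPowerSum x y 2) 2]
  refine sum_congr rfl fun j hj => ?_
  rw [mem_Icc] at hj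
  obtain ⟨p, rfl⟩ : ∃ p, j = p + 2 := ⟨j - 2, by omega⟩
  obtain ⟨q, hq⟩ : ∃ q, d + 1 = p + q := ⟨d + 1 - p, by omega⟩
  rw [show d + 1 + 2 - (p + 2) = q by omega, Nat.add_sub_cancel,
    coeff_limitPowerSum_two x y (by omega), coeff_limitPowerSum_two x y (by omega),
    show d + 5 - (p + 2) - 2 = q by omega, show d + 5 - (p + 2) = q + 2 by omega,
    show d + 5 = p + q + 4 by omega]
  push_cast
  ring

lemma coeff_limitPowerSum_one_sq_mul_two (d : ℕ) :
    coeff (d + 1) (limitPowerSum x y 1 ^ 2 * limitPowerSum x y 2)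
      = -∑ j₁ ∈ Icc 2 (d + 5 - 5), ∑ j₂ ∈ Icc 2 (d + 5 - j₁ - 3),
          (((d + 5 : ℕ) : ℂ) - (j₁ : ℂ) - (j₂ : ℂ) - 1)
            * (x ^ (j₁ - 1) - y ^ (j₁ - 1)) * (x ^ (j₂ - 1) - y ^ (j₂ - 1))
            * (x ^ (d + 5 - j₁ - j₂ - 2) + y ^ (d + 5 - j₁ - j₂ - 2))
            * (rz j₁ : ℂ) * (rz j₂ : ℂ) * (rz (d + 5 - j₁ - j₂) : ℂ) := by
  have h1 := coeff_zero_limitPowerSum x y 1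
  have h2 := coeff_of_lt_one_limitPowerSum x y 2
  rw [pow_two, mul_assoc,
    coeff_mul_eq_sum_Icc h1 (e := 2) (fun k hk => coeff_mul_eq_zero h1 h2 hk) 1, ← sum_neg_distrib]
  refine sum_congr rfl fun j hj => ?_
  rw [mem_Icc] at hj
  rw [coeff_mul_eq_sum_Icc h1 h2 1, mul_sum, ← sum_neg_distrib,
    show d + 1 + 1 - j + 1 - 1 = d + 5 - j - 3 by omega]
  refine sum_congr rfl fun k hk => ?_
  rw [mem_Icc] at hk
  obtain ⟨p, rfl⟩ : ∃ p, j = p + 1 := ⟨j - 1, by omega⟩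
  obtain ⟨q, rfl⟩ : ∃ q, k = q + 1 := ⟨k - 1, by omega⟩
  obtain ⟨s, hs⟩ : ∃ s, d + 1 = p + q + s := ⟨d + 1 - p - q, by omega⟩
  rw [show d + 1 + 1 - (p + 1) + 1 - (q + 1) = s by omega, Nat.add_sub_cancel, Nat.add_sub_cancel,
    coeff_limitPowerSum_one, coeff_limitPowerSum_one, coeff_limitPowerSum_two x y (by omega),
    show d + 5 - (p + 1) - (q + 1) - 2 = s by omega,
    show d + 5 - (p + 1) - (q + 1) = s + 2 by omega, show d + 5 = p + q + s + 4 by omega]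
  push_cast
  ring

lemma coeff_limitPowerSum_one_pow_four (d : ℕ) :
    coeff (d + 1) (limitPowerSum x y 1 ^ 4)
      = ∑ j₁ ∈ Icc 2 (d + 5 - 6), ∑ j₂ ∈ Icc 2 (d + 5 - j₁ - 4),
          ∑ j₃ ∈ Icc 2 (d + 5 - j₁ - j₂ - 2),
          (x ^ (j₁ - 1) - y ^ (j₁ - 1)) * (x ^ (j₂ - 1) - y ^ (j₂ - 1))
            * (x ^ (j₃ - 1) - y ^ (j₃ - 1))
            * (x ^ (d + 5 - j₁ - j₂ - j₃ - 1) - y ^ (d + 5 - j₁ - j₂ - j₃ - 1))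
            * (rz j₁ : ℂ) * (rz j₂ : ℂ) * (rz j₃ : ℂ)
            * (rz (d + 5 - j₁ - j₂ - j₃) : ℂ) := by
  have h1 := coeff_zero_limitPowerSum x y 1
  have h2 := coeff_of_lt_one_limitPowerSum x y 1
  have h3 := fun k => coeff_mul_eq_zero (k := k) h1 h2
  have h4 := fun k => coeff_mul_eq_zero (k := k) h1 h3
  rw [show limitPowerSum x y 1 ^ 4 = limitPowerSum x y 1 * (limitPowerSum x y 1
      * (limitPowerSum x y 1 * limitPowerSum x y 1)) by ring, coeff_mul_eq_sum_Icc h1 h4 1]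
  refine sum_congr rfl fun j hj => ?_
  rw [mem_Icc] at hj
  rw [coeff_mul_eq_sum_Icc h1 h3 1, mul_sum,
    show d + 1 + 1 - j + 1 - (1 + 1) = d + 5 - j - 4 by omega]
  refine sum_congr rfl fun k hk => ?_
  rw [mem_Icc] at hk
  rw [coeff_mul_eq_sum_Icc h1 h2 1, mul_sum, mul_sum,
    show d + 1 + 1 - j + 1 - k + 1 - 1 = d + 5 - j - k - 2 by omega]
  refine sum_congr rfl fun i hi => ?_
  rw [mem_Icc] at hi
  obtain ⟨p, rfl⟩ : ∃ p, j = p + 1 := ⟨j - 1, by omega⟩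
  obtain ⟨q, rfl⟩ : ∃ q, k = q + 1 := ⟨k - 1, by omega⟩
  obtain ⟨s, rfl⟩ : ∃ s, i = s + 1 := ⟨i - 1, by omega⟩
  obtain ⟨t, ht⟩ : ∃ t, d + 1 = p + q + s + t := ⟨d + 1 - p - q - s, by omega⟩
  rw [show d + 1 + 1 - (p + 1) + 1 - (q + 1) + 1 - (s + 1) = t by omega, Nat.add_sub_cancel,
    Nat.add_sub_cancel, Nat.add_sub_cancel, coeff_limitPowerSum_one, coeff_limitPowerSum_one,
    coeff_limitPowerSum_one, coeff_limitPowerSum_one,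
    show d + 5 - (p + 1) - (q + 1) - (s + 1) - 1 = t by omega,
    show d + 5 - (p + 1) - (q + 1) - (s + 1) = t + 1 by omega]
  ring

end Convolution

end GeneratingFunctions

/-- Proposition 4.1 (iii) of Machide: for `l ≥ 5`, an expression for
`G_l^4(x+y,y) + G_l^4(y+x,x)` in terms of Riemann zeta values.  In the double
sums the missing index is `j₂ = l - j₁`; in the triple sum `j₃ = l - j₁ - j₂`;
in the quadruple sum `j₄ = l - j₁ - j₂ - j₃`. -/
theorem depth_four_identity (l : ℕ) (hl : 5 ≤ l) (x y : ℂ) :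
    G l 4 (x + y) y + G l 4 (y + x) x
      = ((l : ℂ) + 1) * ((l : ℂ) ^ 2 - 7 * (l : ℂ) + 18) / 24
            * (x ^ (l - 4) + y ^ (l - 4)) * (rz l : ℂ)
        - (1 / 6) * (∑ j ∈ Finset.Icc 2 (l - 4),
            ((l : ℂ) - (j : ℂ) - 1) * ((l : ℂ) - (j : ℂ) - 2)
              * (x ^ (j - 1) - y ^ (j - 1)) * (x ^ (l - j - 3) - y ^ (l - j - 3))
              * (rz j : ℂ) * (rz (l - j) : ℂ))
        - (1 / 8) * (∑ j ∈ Finset.Icc 3 (l - 3),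
            ((j : ℂ) - 1) * ((l : ℂ) - (j : ℂ) - 1)
              * (x ^ (j - 2) + y ^ (j - 2)) * (x ^ (l - j - 2) + y ^ (l - j - 2))
              * (rz j : ℂ) * (rz (l - j) : ℂ))
        + (1 / 4) * (∑ j₁ ∈ Finset.Icc 2 (l - 5), ∑ j₂ ∈ Finset.Icc 2 (l - j₁ - 3),
            ((l : ℂ) - (j₁ : ℂ) - (j₂ : ℂ) - 1)
              * (x ^ (j₁ - 1) - y ^ (j₁ - 1)) * (x ^ (j₂ - 1) - y ^ (j₂ - 1))
              * (x ^ (l - j₁ - j₂ - 2) + y ^ (l - j₁ - j₂ - 2))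
              * (rz j₁ : ℂ) * (rz j₂ : ℂ) * (rz (l - j₁ - j₂) : ℂ))
        - (1 / 24) * (∑ j₁ ∈ Finset.Icc 2 (l - 6), ∑ j₂ ∈ Finset.Icc 2 (l - j₁ - 4),
            ∑ j₃ ∈ Finset.Icc 2 (l - j₁ - j₂ - 2),
            (x ^ (j₁ - 1) - y ^ (j₁ - 1)) * (x ^ (j₂ - 1) - y ^ (j₂ - 1))
              * (x ^ (j₃ - 1) - y ^ (j₃ - 1))
              * (x ^ (l - j₁ - j₂ - j₃ - 1) - y ^ (l - j₁ - j₂ - j₃ - 1))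
              * (rz j₁ : ℂ) * (rz j₂ : ℂ) * (rz j₃ : ℂ)
              * (rz (l - j₁ - j₂ - j₃) : ℂ)) := by
  obtain ⟨d, rfl⟩ := Nat.exists_eq_add_of_le' hl
  obtain ⟨f, ⟨-, -, -, -, hf⟩, hG⟩ := exists_hasPowerSums_G x y
  have h := congrArg (PowerSeries.coeff (d + 1)) hf
  have hC : ∀ (n : ℕ) (g : PowerSeries ℂ),
      PowerSeries.coeff (d + 1) ((n : PowerSeries ℂ) * g) = n * PowerSeries.coeff (d + 1) g :=
    fun n g => by rw [← map_natCast (PowerSeries.C (R := ℂ)), PowerSeries.coeff_C_mul]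
  have h3 := hC 3 (limitPowerSum x y 2 ^ 2)
  have h6 := hC 6 (limitPowerSum x y 4)
  have h6' := hC 6 (limitPowerSum x y 1 ^ 2 * limitPowerSum x y 2)
  have h8 := hC 8 (limitPowerSum x y 1 * limitPowerSum x y 3)
  have h24 := hC 24 (PowerSeries.coeff 4 f)
  rw [← mul_assoc] at h6' h8
  push_cast at h3 h6 h6' h8 h24
  rw [map_add, map_add, map_add, map_add, h3, h6, h6', h8, h24, coeff_limitPowerSum_one_pow_four,
    coeff_limitPowerSum_one_sq_mul_two, coeff_limitPowerSum_two_sq,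
    coeff_limitPowerSum_one_mul_three, coeff_limitPowerSum_four x y (n := d + 1) d.succ_ne_zero] at h
  rw [hG, show d + 5 - 4 = d + 1 by omega]
  rw [show d + 5 - 4 = d + 1 by omega, show d + 1 + 4 = d + 5 by omega] at h
  push_cast at h ⊢
  linear_combination -h / 24
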